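/- arXiv:2307.12094 — 5 statements merged into one kernel-verified Lean document; each statement's English description precedes it below -/
import Mathlib

section
/- Let G be a finite loopless multigraph and L : E(G) → 2^ℕ a list assignment on the edges of G. If |f(x,L)| ≥ deg(x) + ⌊deg(x)/2⌋ for every vertex x of G, then G admits a proper L-edge-coloring. -/
/-- The degree of a vertex `x` in the multigraph with edge-endpoints map `ends`:
the number of edges incident to `x`. -/
noncomputable def multideg {V E : Type} (ends : E → Sym2 V) (x : V) : ℕ :=
  Nat.card {e : E // x ∈ ends e}

/-- `f(x, L)`: the set of colors common to the lists of all edges incident to `x`. -/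
def listInter {V E : Type} (ends : E → Sym2 V) (L : E → Set ℕ) (x : V) : Set ℕ :=
  {n : ℕ | ∀ e : E, x ∈ ends e → n ∈ L e}

/-- A proper `L`-edge-coloring: every edge gets a color from its list, and distinct
edges sharing an endpoint get distinct colors. -/
def IsProperLEdgeColoring {V E : Type} (ends : E → Sym2 V) (L : E → Set ℕ)
    (φ : E → ℕ) : Prop :=
  (∀ e : E, φ e ∈ L e) ∧
    ∀ e f : E, e ≠ f → (∃ v : V, v ∈ ends e ∧ v ∈ ends f) → φ e ≠ φ f

/-- A stable matching: in a bipartite edge set whose edges are ranked by `c`, increasingly at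
the `a`-ends and decreasingly at the `b`-ends, there is a matching dominating all other edges. -/
lemma exists_stable_matching {V E : Type} [DecidableEq V] [DecidableEq E] (a b : E → V)
    (c : E → ℕ) (T : Finset E)
    (ha : ∀ e ∈ T, ∀ f ∈ T, a e = a f → c e = c f → e = f)
    (hb : ∀ e ∈ T, ∀ f ∈ T, b e = b f → c e = c f → e = f) :
    ∃ K ⊆ T, (∀ e ∈ K, ∀ f ∈ K, a e = a f → e = f) ∧ (∀ e ∈ K, ∀ f ∈ K, b e = b f → e = f) ∧
      ∀ e ∈ T, e ∉ K → ∃ f ∈ K, (a f = a e ∧ c f < c e) ∨ (b f = b e ∧ c e < c f) := by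
  induction T using Finset.strongInduction with
  | H T ih =>
    let X := T.filter (fun e => ∀ f ∈ T, a f = a e → c e ≤ c f)
    have hX : ∀ e, e ∈ X ↔ e ∈ T ∧ ∀ f ∈ T, a f = a e → c e ≤ c f := fun e => by simp [X]
    by_cases hinj : ∀ e ∈ X, ∀ f ∈ X, b e = b f → e = f
    · refine ⟨X, Finset.filter_subset _ _, ?_, hinj, ?_⟩
      · intro e he f hf h
        rw [hX] at he hf
        exact ha e he.1 f hf.1 h (le_antisymm (he.2 f hf.1 h.symm) (hf.2 e he.1 h))
      · intro e he heX
        obtain ⟨f, hf, hmin⟩ := Finset.exists_min_image (T.filter (fun f => a f = a e)) c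
          ⟨e, by simp [he]⟩
        rw [Finset.mem_filter] at hf
        have hfX : f ∈ X := by
          rw [hX]
          exact ⟨hf.1, fun g hg h => hmin g (by simp [hg, h, hf.2])⟩
        refine ⟨f, hfX, Or.inl ⟨hf.2, lt_of_le_of_ne (hmin e (by simp [he])) fun h => ?_⟩⟩
        exact heX (ha f hf.1 e he hf.2 h ▸ hfX)
    · have key : ∃ e ∈ X, ∃ f ∈ X, b e = b f ∧ c e < c f := by
        push Not at hinj
        obtain ⟨e, he, f, hf, h, hne⟩ := hinj
        rcases lt_trichotomy (c e) (c f) with h1 | h1 | h1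
        · exact ⟨e, he, f, hf, h, h1⟩
        · exact absurd (hb e ((hX e).1 he).1 f ((hX f).1 hf).1 h h1) hne
        · exact ⟨f, hf, e, he, h.symm, h1⟩
      obtain ⟨e, he, f, hf, hbe, hlt⟩ := key
      have heT := ((hX e).1 he).1
      have hfT := ((hX f).1 hf).1
      obtain ⟨K, hK, hKa, hKb, hdom⟩ := ih (T.erase e) (Finset.erase_ssubset heT)
        (fun x hx y hy => ha x (Finset.mem_of_mem_erase hx) y (Finset.mem_of_mem_erase hy))
        (fun x hx y hy => hb x (Finset.mem_of_mem_erase hx) y (Finset.mem_of_mem_erase hy))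
      refine ⟨K, hK.trans (Finset.erase_subset _ _), hKa, hKb, fun x hx hxK => ?_⟩
      by_cases hxe : x = e
      · subst hxe
        by_cases hfK : f ∈ K
        · exact ⟨f, hfK, Or.inr ⟨hbe.symm, hlt⟩⟩
        · have hne : f ≠ x := by rintro rfl; exact lt_irrefl _ hlt
          obtain ⟨g, hg, h | h⟩ := hdom f (Finset.mem_erase.2 ⟨hne, hfT⟩) hfK
          · exact absurd (((hX f).1 hf).2 g (Finset.mem_of_mem_erase (hK hg)) h.1) (not_le.2 h.2)
          · exact ⟨g, hg, Or.inr ⟨h.1.trans hbe.symm, hlt.trans h.2⟩⟩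
      · exact hdom x (Finset.mem_erase.2 ⟨hxe, hx⟩) hxK

/-- Galvin's lemma: lists larger than the out-degrees of the ranking `c` admit a coloring. -/
lemma exists_list_coloring_of_ranking {V E : Type} [DecidableEq V] [DecidableEq E] (a b : E → V)
    (c : E → ℕ) (S : Finset E) (L : E → Finset ℕ)
    (ha : ∀ e ∈ S, ∀ f ∈ S, a e = a f → c e = c f → e = f)
    (hb : ∀ e ∈ S, ∀ f ∈ S, b e = b f → c e = c f → e = f)
    (hL : ∀ e ∈ S, (S.filter (fun f => a f = a e ∧ c f < c e)).card +
      (S.filter (fun f => b f = b e ∧ c e < c f)).card < (L e).card) :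
    ∃ φ : E → ℕ, (∀ e ∈ S, φ e ∈ L e) ∧
      ∀ e ∈ S, ∀ f ∈ S, e ≠ f → (a e = a f ∨ b e = b f) → φ e ≠ φ f := by
  induction S using Finset.strongInduction generalizing L with
  | H S ih =>
    rcases S.eq_empty_or_nonempty with rfl | ⟨e₀, he₀⟩
    · exact ⟨fun _ => 0, by simp, by simp⟩
    obtain ⟨α, hα⟩ : (L e₀).Nonempty := Finset.card_pos.1 (by have := hL e₀ he₀; omega)
    obtain ⟨K, hKT, hKa, hKb, hdom⟩ :=
      exists_stable_matching a b c (S.filter (fun e => α ∈ L e))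
        (fun x hx y hy => ha x (Finset.mem_of_mem_filter x hx) y (Finset.mem_of_mem_filter y hy))
        (fun x hx y hy => hb x (Finset.mem_of_mem_filter x hx) y (Finset.mem_of_mem_filter y hy))
    have hKS : K ⊆ S := hKT.trans (Finset.filter_subset _ _)
    have hKne : K.Nonempty := by
      by_cases h : e₀ ∈ K
      · exact ⟨e₀, h⟩
      · obtain ⟨f, hf, -⟩ := hdom e₀ (by simp [he₀, hα]) h
        exact ⟨f, hf⟩
    obtain ⟨φ, hφ, hprop⟩ := ih (S \ K) (Finset.sdiff_ssubset hKS hKne)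
      (fun e => (L e).erase α)
      (fun x hx y hy => ha x (Finset.sdiff_subset hx) y (Finset.sdiff_subset hy))
      (fun x hx y hy => hb x (Finset.sdiff_subset hx) y (Finset.sdiff_subset hy)) (by
        intro e he
        rw [Finset.mem_sdiff] at he
        have h0 := hL e he.1
        have h1 : ((S \ K).filter (fun f => a f = a e ∧ c f < c e)).card ≤
            (S.filter (fun f => a f = a e ∧ c f < c e)).card :=
          Finset.card_le_card (Finset.filter_subset_filter _ Finset.sdiff_subset)
        have h2 : ((S \ K).filter (fun f => b f = b e ∧ c e < c f)).card ≤
            (S.filter (fun f => b f = b e ∧ c e < c f)).card :=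
          Finset.card_le_card (Finset.filter_subset_filter _ Finset.sdiff_subset)
        by_cases hαe : α ∈ L e
        · rw [Finset.card_erase_of_mem hαe]
          obtain ⟨f, hf, h | h⟩ := hdom e (by simp [he.1, hαe]) he.2
          · have : ((S \ K).filter (fun f => a f = a e ∧ c f < c e)).card <
                (S.filter (fun f => a f = a e ∧ c f < c e)).card := by
              refine Finset.card_lt_card (Finset.ssubset_iff_subset_ne.2
                ⟨Finset.filter_subset_filter _ Finset.sdiff_subset, fun heq => ?_⟩)
              have : f ∈ S.filter (fun f => a f = a e ∧ c f < c e) := by simp [hKS hf, h]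
              rw [← heq] at this
              simp [hf] at this
            omega
          · have : ((S \ K).filter (fun f => b f = b e ∧ c e < c f)).card <
                (S.filter (fun f => b f = b e ∧ c e < c f)).card := by
              refine Finset.card_lt_card (Finset.ssubset_iff_subset_ne.2
                ⟨Finset.filter_subset_filter _ Finset.sdiff_subset, fun heq => ?_⟩)
              have : f ∈ S.filter (fun f => b f = b e ∧ c e < c f) := by simp [hKS hf, h]
              rw [← heq] at this
              simp [hf] at this
            omega
        · rw [Finset.erase_eq_of_notMem hαe]
          omega)
    have hne : ∀ e ∈ S, e ∉ K → φ e ≠ α ∧ φ e ∈ L e := fun e he heK => by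
      simpa using hφ e (by simp [he, heK])
    refine ⟨fun e => if e ∈ K then α else φ e, fun e he => ?_, fun e he f hf hef hadj => ?_⟩
    · by_cases heK : e ∈ K
      · simpa [heK] using (Finset.mem_filter.1 (hKT heK)).2
      · simpa [heK] using (hne e he heK).2
    · by_cases heK : e ∈ K <;> by_cases hfK : f ∈ K <;> simp only [heK, hfK, if_true, if_false]
      · rcases hadj with h | h
        · exact absurd (hKa e heK f hfK h) hef
        · exact absurd (hKb e heK f hfK h) hef
      · exact (hne f hf hfK).1.symm
      · exact (hne e he heK).1
      · exact hprop e (by simp [he, heK]) f (by simp [hf, hfK]) hef hadj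

/-- Some nonempty set of vertices of degree greater than `k` on the `a`-side is at least as large
as the corresponding set on the `b`-side. -/
lemma exists_degree_threshold {V E : Type} [Fintype V] [DecidableEq V]
    (a b : E → V) (S : Finset E) (hS : S.Nonempty) :
    ∃ k, (Finset.univ.filter (fun x => k < (S.filter (fun e => a e = x)).card)).Nonempty ∧
      (Finset.univ.filter (fun x => k < (S.filter (fun e => b e = x)).card)).card ≤
      (Finset.univ.filter (fun x => k < (S.filter (fun e => a e = x)).card)).card := by
  have hsum : ∀ g : E → V, ∑ k ∈ Finset.range S.card,
      (Finset.univ.filter (fun x => k < (S.filter (fun e => g e = x)).card)).card = S.card := by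
    intro g
    simp_rw [Finset.card_filter _ (Finset.univ : Finset V)]
    rw [Finset.sum_comm]
    conv_rhs => rw [Finset.card_eq_sum_card_fiberwise (f := g) (t := Finset.univ)
      (fun _ _ => Finset.mem_coe.2 (Finset.mem_univ _))]
    refine Finset.sum_congr rfl fun x _ => ?_
    rw [← Finset.card_filter]
    have hle : (S.filter (fun e => g e = x)).card ≤ S.card := Finset.card_filter_le _ _
    have : (Finset.range S.card).filter (fun k => k < (S.filter (fun e => g e = x)).card) =
        Finset.range (S.filter (fun e => g e = x)).card := by
      ext k
      simp only [Finset.mem_filter, Finset.mem_range]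
      omega
    rw [this, Finset.card_range]
  by_contra! hcon
  obtain ⟨e₀, he₀⟩ := hS
  have h0 : (Finset.univ.filter (fun x => 0 < (S.filter (fun e => a e = x)).card)).Nonempty :=
    ⟨a e₀, by simpa using Finset.card_pos.2 ⟨e₀, by simp [he₀]⟩⟩
  have := Finset.sum_lt_sum (s := Finset.range S.card)
    (f := fun k => (Finset.univ.filter (fun x => k < (S.filter (fun e => a e = x)).card)).card)
    (g := fun k => (Finset.univ.filter (fun x => k < (S.filter (fun e => b e = x)).card)).card)
    (fun k _ => by
      rcases Finset.eq_empty_or_nonempty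
        (Finset.univ.filter (fun x => k < (S.filter (fun e => a e = x)).card)) with h | h
      · simp only [h, Finset.card_empty, Nat.zero_le]
      · exact (hcon k h).le)
    ⟨0, Finset.mem_range.2 (Finset.card_pos.2 ⟨e₀, he₀⟩), hcon 0 h0⟩
  rw [hsum, hsum] at this
  exact lt_irrefl _ this

/-- A nonempty bipartite edge set contains a nonempty matching such that every neighbor, of at
least the same degree, of a covered `a`-vertex is covered as well. -/
lemma exists_degree_closed_matching {V E : Type} [Fintype V] [DecidableEq V] [DecidableEq E]
    (a b : E → V) (S : Finset E) (hS : S.Nonempty) :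
    ∃ M ⊆ S, M.Nonempty ∧ (∀ e ∈ M, ∀ f ∈ M, a e = a f → e = f) ∧
      (∀ e ∈ M, ∀ f ∈ M, b e = b f → e = f) ∧
      ∀ m ∈ M, ∀ e ∈ S, a e = a m →
        (S.filter (fun f => a f = a e)).card ≤ (S.filter (fun f => b f = b e)).card →
        ∃ m' ∈ M, b m' = b e := by
  let N : Finset V → Finset V := fun U => (S.filter (fun e => a e ∈ U ∧
    (S.filter (fun f => a f = a e)).card ≤ (S.filter (fun f => b f = b e)).card)).image b
  have hN : ∀ U y, y ∈ N U ↔ ∃ e ∈ S, a e ∈ U ∧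
      (S.filter (fun f => a f = a e)).card ≤ (S.filter (fun f => b f = b e)).card ∧ b e = y := by
    intro U y
    simp only [N, Finset.mem_image, Finset.mem_filter, and_assoc]
  have hNmono : ∀ U U', U ⊆ U' → N U ⊆ N U' := by
    intro U U' h y
    rw [hN, hN]
    rintro ⟨e, he, h1, h2⟩
    exact ⟨e, he, h h1, h2⟩
  let P : Finset V → Prop := fun U => U.Nonempty ∧ (∀ x ∈ U, ∃ e ∈ S, a e = x) ∧
    (N U).card ≤ U.card
  obtain ⟨U, hU, hmin⟩ : ∃ U, P U ∧ ∀ U' ⊂ U, ¬ P U' := by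
    obtain ⟨k, hne, hle⟩ := exists_degree_threshold a b S hS
    have hP : P (Finset.univ.filter (fun x => k < (S.filter (fun e => a e = x)).card)) := by
      refine ⟨hne, fun x hx => ?_, le_trans (Finset.card_le_card fun y hy => ?_) hle⟩
      · rw [Finset.mem_filter] at hx
        obtain ⟨e, he⟩ := Finset.card_pos.1 (lt_of_le_of_lt (Nat.zero_le k) hx.2)
        exact ⟨e, (Finset.mem_filter.1 he).1, (Finset.mem_filter.1 he).2⟩
      · obtain ⟨e, he, h1, h2, rfl⟩ := (hN _ _).1 hy
        rw [Finset.mem_filter] at h1 ⊢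
        exact ⟨Finset.mem_univ _, h1.2.trans_le h2⟩
    obtain ⟨U, hU, hmin⟩ := WellFounded.has_min (r := fun U U' : Finset V => U ⊂ U')
      Finset.isWellFounded_ssubset.wf {U | P U} ⟨_, hP⟩
    exact ⟨U, hU, fun U' h h' => hmin U' h' h⟩
  obtain ⟨⟨x₀, hx₀⟩, hUS, hUcard⟩ := hU
  rcases (N U).eq_empty_or_nonempty with hemp | hne
  · obtain ⟨e, he, rfl⟩ := hUS x₀ hx₀
    refine ⟨{e}, by simpa using he, by simp, by simp, by simp, fun m hm f hf h hle => ?_⟩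
    rw [Finset.mem_singleton] at hm
    subst hm
    have : b f ∈ N U := (hN _ _).2 ⟨f, hf, h ▸ hx₀, hle, rfl⟩
    simp [hemp] at this
  · have hproper : ∀ U' ⊂ U, U'.card ≤ (N U').card := by
      intro U' h
      rcases U'.eq_empty_or_nonempty with rfl | hne'
      · simp
      · by_contra hcon
        exact hmin U' h ⟨hne', fun x hx => hUS x (h.1 hx), by omega⟩
    have hUeq : U.card ≤ (N U).card := by
      by_contra hcon
      have h1 := Finset.card_pos.2 hne
      have h2 := Finset.card_erase_of_mem hx₀
      have hss := Finset.erase_ssubset hx₀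
      refine hmin _ hss ⟨Finset.card_pos.1 (by omega), fun x hx => hUS x (hss.1 hx), ?_⟩
      have := Finset.card_le_card (hNmono _ _ hss.1)
      omega
    obtain ⟨g, hginj, hg⟩ := (Finset.all_card_le_biUnion_card_iff_exists_injective
      (fun x : {x // x ∈ U} => N {x.1})).1 (by
        intro s
        have hs : s.biUnion (fun x => N {x.1}) = N (s.map (Function.Embedding.subtype _)) := by
          ext y
          simp only [Finset.mem_biUnion, hN, Finset.mem_singleton, Finset.mem_map,
            Function.Embedding.subtype_apply]
          constructor
          · rintro ⟨x, hx, e, he, h1, h2⟩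
            exact ⟨e, he, ⟨x, hx, h1.symm⟩, h2⟩
          · rintro ⟨e, he, ⟨x, hx, h1⟩, h2⟩
            exact ⟨x, hx, e, he, h1.symm, h2⟩
        rw [hs, ← Finset.card_map (Function.Embedding.subtype _) (s := s)]
        have hsub : s.map (Function.Embedding.subtype _) ⊆ U := by
          intro x hx
          obtain ⟨y, -, rfl⟩ := Finset.mem_map.1 hx
          exact y.2
        rcases hsub.eq_or_ssubset with h | h
        · rw [h]; exact hUeq
        · exact hproper _ h)
    have hm : ∀ x : {x // x ∈ U}, ∃ e ∈ S, a e = x.1 ∧ b e = g x := by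
      intro x
      obtain ⟨e, he, h1, -, h2⟩ := (hN _ _).1 (hg x)
      exact ⟨e, he, Finset.mem_singleton.1 h1, h2⟩
    choose m hmS hma hmb using hm
    have himg : Finset.univ.image g = N U := by
      refine Finset.eq_of_subset_of_card_le (fun y hy => ?_) ?_
      · obtain ⟨x, -, rfl⟩ := Finset.mem_image.1 hy
        exact hNmono _ _ (Finset.singleton_subset_iff.2 x.2) (hg x)
      · rw [Finset.card_image_of_injective _ hginj]
        simpa using hUcard
    refine ⟨Finset.univ.image m, ?_, ⟨m ⟨x₀, hx₀⟩, by simp⟩, ?_, ?_, ?_⟩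
    · intro e he
      obtain ⟨x, -, rfl⟩ := Finset.mem_image.1 he
      exact hmS x
    · intro e he f hf h
      obtain ⟨x, -, rfl⟩ := Finset.mem_image.1 he
      obtain ⟨y, -, rfl⟩ := Finset.mem_image.1 hf
      rw [hma, hma] at h
      rw [Subtype.ext h]
    · intro e he f hf h
      obtain ⟨x, -, rfl⟩ := Finset.mem_image.1 he
      obtain ⟨y, -, rfl⟩ := Finset.mem_image.1 hf
      rw [hmb, hmb] at h
      rw [hginj h]
    · intro e he f hf h hle
      obtain ⟨x, -, rfl⟩ := Finset.mem_image.1 he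
      have hfN : b f ∈ N U := (hN _ _).2 ⟨f, hf, by rw [h, hma]; exact x.2, hle, rfl⟩
      rw [← himg] at hfN
      obtain ⟨y, -, hy⟩ := Finset.mem_image.1 hfN
      exact ⟨m y, by simp, by rw [hmb, hy]⟩

/-- A bipartite edge set has a proper edge ranking whose out-degrees are smaller than the larger
degree of the two ends. -/
lemma exists_ranking {V E : Type} [Fintype V] [DecidableEq V] [DecidableEq E]
    (a b : E → V) (S : Finset E) :
    ∃ c : E → ℕ, (∀ e ∈ S, ∀ f ∈ S, a e = a f → c e = c f → e = f) ∧
      (∀ e ∈ S, ∀ f ∈ S, b e = b f → c e = c f → e = f) ∧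
      ∀ e ∈ S, (S.filter (fun f => a f = a e ∧ c f < c e)).card +
        (S.filter (fun f => b f = b e ∧ c e < c f)).card <
        max (S.filter (fun f => a f = a e)).card (S.filter (fun f => b f = b e)).card := by
  induction S using Finset.strongInduction with
  | H S ih =>
    rcases S.eq_empty_or_nonempty with rfl | hS
    · exact ⟨fun _ => 0, by simp, by simp, by simp⟩
    obtain ⟨M, hMS, hMne, hMa, hMb, hM⟩ := exists_degree_closed_matching a b S hS
    obtain ⟨c, hca, hcb, hc⟩ := ih (S \ M) (Finset.sdiff_ssubset hMS hMne)
    have hproper : ∀ g : E → V, (∀ e ∈ M, ∀ f ∈ M, g e = g f → e = f) →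
        (∀ e ∈ S \ M, ∀ f ∈ S \ M, g e = g f → c e = c f → e = f) →
        ∀ e ∈ S, ∀ f ∈ S, g e = g f →
          (if e ∈ M then 0 else c e + 1) = (if f ∈ M then 0 else c f + 1) → e = f := by
      intro g h1 h2 e he f hf h heq
      by_cases heM : e ∈ M <;> by_cases hfM : f ∈ M <;>
        simp only [heM, hfM, if_true, if_false] at heq
      · exact h1 e heM f hfM h
      · omega
      · omega
      · exact h2 e (by simp [he, heM]) f (by simp [hf, hfM]) h (by omega)
    refine ⟨fun e => if e ∈ M then 0 else c e + 1, hproper a hMa hca, hproper b hMb hcb, ?_⟩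
    intro e he
    have hsplit : ∀ p : E → Prop, ∀ _ : DecidablePred p, (S.filter p).card =
        ((S \ M).filter p).card + (M.filter p).card := by
      intro p _
      rw [← Finset.card_union_of_disjoint
        (Finset.disjoint_filter_filter Finset.sdiff_disjoint), ← Finset.filter_union,
        Finset.sdiff_union_of_subset hMS]
    by_cases heM : e ∈ M
    · have h1 : S.filter (fun f => a f = a e ∧
          (if f ∈ M then 0 else c f + 1) < (if e ∈ M then 0 else c e + 1)) = ∅ := by
        simp [heM]
      have h2 : (S.filter (fun f => b f = b e ∧
          (if e ∈ M then 0 else c e + 1) < (if f ∈ M then 0 else c f + 1))).card <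
          (S.filter (fun f => b f = b e)).card := by
        refine Finset.card_lt_card (Finset.ssubset_iff_subset_ne.2
          ⟨fun f hf => ?_, fun heq => ?_⟩)
        · rw [Finset.mem_filter] at hf ⊢
          exact ⟨hf.1, hf.2.1⟩
        · have : e ∈ S.filter (fun f => b f = b e) := by simp [he]
          rw [← heq] at this
          simp at this
      rw [h1, Finset.card_empty, zero_add]
      exact lt_max_of_lt_right h2
    · have h1 : (S.filter (fun f => a f = a e ∧
          (if f ∈ M then 0 else c f + 1) < (if e ∈ M then 0 else c e + 1))).card =
          ((S \ M).filter (fun f => a f = a e ∧ c f < c e)).card +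
            (M.filter (fun f => a f = a e)).card := by
        rw [hsplit]
        congr 2
        · refine Finset.filter_congr fun f hf => ?_
          simp [(Finset.mem_sdiff.1 hf).2, heM]
        · refine Finset.filter_congr fun f hf => ?_
          simp [hf, heM]
      have h2 : (S.filter (fun f => b f = b e ∧
          (if e ∈ M then 0 else c e + 1) < (if f ∈ M then 0 else c f + 1))).card =
          ((S \ M).filter (fun f => b f = b e ∧ c e < c f)).card := by
        rw [hsplit]
        have hz : M.filter (fun f => b f = b e ∧
          (if e ∈ M then 0 else c e + 1) < (if f ∈ M then 0 else c f + 1)) = ∅ := by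
          refine Finset.filter_eq_empty_iff.2 fun f hf => ?_
          simp [hf]
        rw [hz, Finset.card_empty, add_zero]
        congr 1
        refine Finset.filter_congr fun f hf => ?_
        simp [(Finset.mem_sdiff.1 hf).2, heM]
      rw [h1, h2]
      have h3 := hc e (by simp [he, heM])
      have h4 := hsplit (fun f => a f = a e) inferInstance
      have h5 := hsplit (fun f => b f = b e) inferInstance
      have h6 : (M.filter (fun f => a f = a e)).card ≤ 1 := by
        refine Finset.card_le_one.2 fun x hx y hy => ?_
        rw [Finset.mem_filter] at hx hy
        exact hMa x hx.1 y hy.1 (hx.2.trans hy.2.symm)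
      rcases Nat.eq_zero_or_pos (M.filter (fun f => a f = a e)).card with h7 | h7
      · omega
      · obtain ⟨m, hm⟩ := Finset.card_pos.1 h7
        rw [Finset.mem_filter] at hm
        by_cases hle : (S.filter (fun f => a f = a e)).card ≤ (S.filter (fun f => b f = b e)).card
        · obtain ⟨m', hm', hb'⟩ := hM m hm.1 e he hm.2.symm hle
          have : 0 < (M.filter (fun f => b f = b e)).card :=
            Finset.card_pos.2 ⟨m', by simp [hm', hb']⟩
          omega
        · omega

/-- Bipartite list edge coloring with lists as large as the larger degree of the two ends. -/
lemma bipartite_list_edge_coloring {V E : Type} [Fintype V] [DecidableEq V] [DecidableEq E]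
    (a b : E → V) (S : Finset E) (L : E → Finset ℕ)
    (hL : ∀ e ∈ S, max (S.filter (fun f => a f = a e)).card
      (S.filter (fun f => b f = b e)).card ≤ (L e).card) :
    ∃ φ : E → ℕ, (∀ e ∈ S, φ e ∈ L e) ∧
      ∀ e ∈ S, ∀ f ∈ S, e ≠ f → (a e = a f ∨ b e = b f) → φ e ≠ φ f := by
  obtain ⟨c, hca, hcb, hc⟩ := exists_ranking a b S
  exact exists_list_coloring_of_ranking a b c S L hca hcb
    fun e he => (hc e he).trans_le (hL e he)

/-- Greedy list coloring of a finite set with respect to a symmetric conflict relation. -/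
lemma exists_greedy_list_coloring {E : Type} [DecidableEq E] (adj : E → E → Prop)
    [DecidableRel adj] (hsymm : ∀ e f, adj e f → adj f e) (S : Finset E) (L : E → Finset ℕ)
    (hL : ∀ e ∈ S, (S.filter (adj e)).card < (L e).card) :
    ∃ φ : E → ℕ, (∀ e ∈ S, φ e ∈ L e) ∧
      ∀ e ∈ S, ∀ f ∈ S, e ≠ f → adj e f → φ e ≠ φ f := by
  induction S using Finset.induction_on with
  | empty => exact ⟨fun _ => 0, by simp, by simp⟩
  | insert x S hx ih =>
    obtain ⟨φ, hφ, hprop⟩ := ih fun e he => lt_of_le_of_lt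
      (Finset.card_le_card (Finset.filter_subset_filter _ (Finset.subset_insert x S)))
      (hL e (Finset.mem_insert_of_mem he))
    obtain ⟨α, hα, hα'⟩ : ∃ α ∈ L x, α ∉ (S.filter (adj x)).image φ := by
      refine Finset.exists_mem_notMem_of_card_lt_card (lt_of_le_of_lt ?_
        (hL x (Finset.mem_insert_self x S)))
      exact Finset.card_image_le.trans
        (Finset.card_le_card (Finset.filter_subset_filter _ (Finset.subset_insert x S)))
    have hne : ∀ f ∈ S, adj x f → φ f ≠ α := fun f hf h heq =>
      hα' (Finset.mem_image.2 ⟨f, by simp [hf, h], heq⟩)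
    refine ⟨Function.update φ x α, fun e he => ?_, fun e he f hf hef hadj => ?_⟩
    · by_cases h : e = x
      · subst h; simpa using hα
      · simpa [h] using hφ e (Finset.mem_of_mem_insert_of_ne he h)
    · by_cases h : e = x <;> by_cases h' : f = x
      · exact absurd (h.trans h'.symm) hef
      · subst h
        simpa [h'] using (hne f (Finset.mem_of_mem_insert_of_ne hf h') hadj).symm
      · subst h'
        simpa [h] using hne e (Finset.mem_of_mem_insert_of_ne he h) (hsymm _ _ hadj)
      · simpa [h, h'] using hprop e (Finset.mem_of_mem_insert_of_ne he h) f
          (Finset.mem_of_mem_insert_of_ne hf h') hef hadj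

/-- A maximum cut: at every vertex at most half of the edges have both ends on the same side. -/
lemma exists_balanced_cut {V E : Type} [Fintype V] [DecidableEq V] [Fintype E]
    (u v : E → V) (huv : ∀ e, u e ≠ v e) :
    ∃ σ : V → Bool, ∀ x,
      2 * (Finset.univ.filter (fun e => (u e = x ∨ v e = x) ∧ σ (u e) = σ (v e))).card ≤
        (Finset.univ.filter (fun e => u e = x ∨ v e = x)).card := by
  obtain ⟨σ, hσ⟩ := Finite.exists_max
    (fun σ : V → Bool => (Finset.univ.filter (fun e => σ (u e) ≠ σ (v e))).card)
  refine ⟨σ, fun x => ?_⟩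
  have h := hσ (Function.update σ x (!σ x))
  have hsplit : ∀ (p q : E → Prop) (_ : DecidablePred p) (_ : DecidablePred q),
      (Finset.univ.filter p).card = (Finset.univ.filter (fun e => q e ∧ p e)).card +
        (Finset.univ.filter (fun e => ¬ q e ∧ p e)).card := by
    intro p q _ _
    rw [← Finset.card_filter_add_card_filter_not (s := Finset.univ.filter p) q,
      Finset.filter_filter, Finset.filter_filter]
    simp only [and_comm]
  have h1 := hsplit (fun e => σ (u e) ≠ σ (v e)) (fun e => u e = x ∨ v e = x)
    inferInstance inferInstance
  have h2 := hsplit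
    (fun e => Function.update σ x (!σ x) (u e) ≠ Function.update σ x (!σ x) (v e))
    (fun e => u e = x ∨ v e = x) inferInstance inferInstance
  have h3 := hsplit (fun e => u e = x ∨ v e = x) (fun e => σ (u e) = σ (v e))
    inferInstance inferInstance
  have h4 : Finset.univ.filter (fun e => (u e = x ∨ v e = x) ∧
      Function.update σ x (!σ x) (u e) ≠ Function.update σ x (!σ x) (v e)) =
      Finset.univ.filter (fun e => σ (u e) = σ (v e) ∧ (u e = x ∨ v e = x)) := by
    refine Finset.filter_congr fun e _ => ?_
    have := huv e
    by_cases hu : u e = x <;> by_cases hv : v e = x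
    · exact absurd (hu.trans hv.symm) this
    · subst hu
      simp [hv]
    · subst hv
      simp [hu]
    · simp [hu, hv]
  have h5 : Finset.univ.filter (fun e => ¬ (u e = x ∨ v e = x) ∧
      Function.update σ x (!σ x) (u e) ≠ Function.update σ x (!σ x) (v e)) =
      Finset.univ.filter (fun e => ¬ (u e = x ∨ v e = x) ∧ σ (u e) ≠ σ (v e)) := by
    refine Finset.filter_congr fun e _ => ?_
    by_cases hu : u e = x <;> by_cases hv : v e = x <;> simp [hu, hv]
  have h6 : Finset.univ.filter (fun e => (u e = x ∨ v e = x) ∧ σ (u e) = σ (v e)) =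
      Finset.univ.filter (fun e => σ (u e) = σ (v e) ∧ (u e = x ∨ v e = x)) :=
    Finset.filter_congr fun e _ => and_comm
  have h7 : Finset.univ.filter (fun e => (u e = x ∨ v e = x) ∧ σ (u e) ≠ σ (v e)) =
      Finset.univ.filter (fun e => ¬ σ (u e) = σ (v e) ∧ (u e = x ∨ v e = x)) :=
    Finset.filter_congr fun e _ => and_comm
  rw [h4, h5] at h2
  rw [h7] at h1
  rw [h6]
  omega

/-- **Local Shannon theorem for lists.** If `G` is a finite loopless multigraph and
`L` is a list assignment on its edges with `|f(x,L)| ≥ deg(x) + ⌊deg(x)/2⌋` for every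
vertex `x`, then `G` admits a proper `L`-edge-coloring. -/
theorem local_shannon_list_edge_coloring {V E : Type} [Fintype V] [Fintype E]
    (ends : E → Sym2 V) (hloopless : ∀ e : E, ¬ (ends e).IsDiag)
    (L : E → Set ℕ)
    (hf : ∀ x : V,
      ((multideg ends x + multideg ends x / 2 : ℕ) : ℕ∞) ≤ (listInter ends L x).encard) :
    ∃ φ : E → ℕ, IsProperLEdgeColoring ends L φ := by
  classical
  have hends : ∀ e, ∃ p : V × V, ends e = s(p.1, p.2) := fun e => by
    induction ends e using Sym2.ind with
    | _ x y => exact ⟨(x, y), rfl⟩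
  choose p hp using hends
  have hne : ∀ e, (p e).1 ≠ (p e).2 := fun e h => hloopless e (by rw [hp e]; simpa using h)
  obtain ⟨σ, hσ⟩ := exists_balanced_cut (fun e => (p e).1) (fun e => (p e).2) hne
  have hmem : ∀ e x, x ∈ ends e ↔ (p e).1 = x ∨ (p e).2 = x := fun e x => by
    rw [hp e, Sym2.mem_iff, eq_comm, @eq_comm _ x]
  let cut : E → Prop := fun e => σ (p e).1 ≠ σ (p e).2
  let H : Finset E := Finset.univ.filter cut
  let R : Finset E := Finset.univ.filter (fun e => ¬ cut e)
  have hdeg : ∀ x, multideg ends x = (H.filter (fun e => x ∈ ends e)).card +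
      (R.filter (fun e => x ∈ ends e)).card := by
    intro x
    rw [multideg, Nat.card_eq_fintype_card, Fintype.card_subtype,
      ← Finset.card_filter_add_card_filter_not (s := Finset.univ.filter (fun e => x ∈ ends e)) cut,
      Finset.filter_comm, Finset.filter_comm (p := fun e => x ∈ ends e)]
  have hhalf : ∀ x, 2 * (R.filter (fun e => x ∈ ends e)).card ≤ multideg ends x := by
    intro x
    have h := hσ x
    rw [multideg, Nat.card_eq_fintype_card, Fintype.card_subtype]
    have h1 : R.filter (fun e => x ∈ ends e) = Finset.univ.filter (fun e =>
        ((p e).1 = x ∨ (p e).2 = x) ∧ σ (p e).1 = σ (p e).2) := by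
      ext e
      simp [R, cut, hmem, and_comm]
    rw [h1]
    simpa only [hmem] using h
  have hfin : ∀ x, ∃ F : Finset ℕ, (F : Set ℕ) ⊆ listInter ends L x ∧
      F.card = multideg ends x + multideg ends x / 2 := by
    intro x
    obtain ⟨t, ht, hcard⟩ := Set.exists_subset_encard_eq (hf x)
    have htfin : t.Finite := Set.finite_of_encard_eq_coe hcard
    refine ⟨htfin.toFinset, by simpa using ht, ?_⟩
    rw [htfin.encard_eq_coe_toFinset_card] at hcard
    exact_mod_cast hcard
  choose F hFsub hFcard using hfin
  let L' : E → Finset ℕ := fun e => F (p e).1 ∪ F (p e).2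
  have hL'sub : ∀ e, ∀ n ∈ L' e, n ∈ L e := by
    intro e n hn
    rcases Finset.mem_union.1 hn with h | h
    · exact hFsub _ h e ((hmem _ _).2 (Or.inl rfl))
    · exact hFsub _ h e ((hmem _ _).2 (Or.inr rfl))
  have hL'1 : ∀ e, multideg ends (p e).1 + multideg ends (p e).1 / 2 ≤ (L' e).card := fun e =>
    (hFcard _).symm.trans_le (Finset.card_le_card Finset.subset_union_left)
  have hL'2 : ∀ e, multideg ends (p e).2 + multideg ends (p e).2 / 2 ≤ (L' e).card := fun e =>
    (hFcard _).symm.trans_le (Finset.card_le_card Finset.subset_union_right)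
  let adj : E → E → Prop := fun e f => ∃ x, x ∈ ends e ∧ x ∈ ends f
  have hadj : ∀ e, (R.filter (adj e)).card ≤ (R.filter (fun f => (p e).1 ∈ ends f)).card +
      (R.filter (fun f => (p e).2 ∈ ends f)).card := by
    intro e
    refine le_trans (Finset.card_le_card fun f hf => ?_) (Finset.card_union_le _ _)
    obtain ⟨hfR, x, hxe, hxf⟩ := Finset.mem_filter.1 hf
    rcases (hmem e x).1 hxe with rfl | rfl
    · exact Finset.mem_union_left _ (Finset.mem_filter.2 ⟨hfR, hxf⟩)
    · exact Finset.mem_union_right _ (Finset.mem_filter.2 ⟨hfR, hxf⟩)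
  obtain ⟨ψ, hψ, hψprop⟩ := exists_greedy_list_coloring adj
    (fun e f ⟨x, h, h'⟩ => ⟨x, h', h⟩) R L' (by
      intro e he
      have h1 : 0 < (R.filter (fun f => (p e).1 ∈ ends f)).card :=
        Finset.card_pos.2 ⟨e, by simp [he, hmem]⟩
      have h2 := hadj e
      have h3 := hhalf (p e).1
      have h4 := hhalf (p e).2
      have h5 := hL'1 e
      have h6 := hL'2 e
      omega)
  let a : E → V := fun e => if σ (p e).1 then (p e).1 else (p e).2
  let b : E → V := fun e => if σ (p e).1 then (p e).2 else (p e).1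
  have hab : ∀ e, (a e = (p e).1 ∧ b e = (p e).2) ∨ (a e = (p e).2 ∧ b e = (p e).1) := by
    intro e
    cases h : σ (p e).1 <;> simp [a, b, h]
  have hmemab : ∀ e x, x ∈ ends e ↔ a e = x ∨ b e = x := by
    intro e x
    rw [hmem]
    rcases hab e with ⟨h, h'⟩ | ⟨h, h'⟩ <;> rw [h, h']
    exact or_comm
  have hσa : ∀ e ∈ H, σ (a e) = true := by
    intro e he
    have : σ (p e).1 ≠ σ (p e).2 := (Finset.mem_filter.1 he).2
    cases h : σ (p e).1 <;> cases h' : σ (p e).2 <;> simp_all [a]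
  have hσb : ∀ e ∈ H, σ (b e) = false := by
    intro e he
    have : σ (p e).1 ≠ σ (p e).2 := (Finset.mem_filter.1 he).2
    cases h : σ (p e).1 <;> cases h' : σ (p e).2 <;> simp_all [b]
  obtain ⟨φ, hφ, hφprop⟩ := bipartite_list_edge_coloring a b H
    (fun e => L' e \ (R.filter (adj e)).image ψ) (by
      intro e he
      have h0 := Finset.le_card_sdiff ((R.filter (adj e)).image ψ) (L' e)
      have h1 : ((R.filter (adj e)).image ψ).card ≤ (R.filter (adj e)).card :=
        Finset.card_image_le
      have h2 := hadj e
      have h3 := hhalf (p e).1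
      have h4 := hhalf (p e).2
      have h5 := hL'1 e
      have h6 := hL'2 e
      have h7 := hdeg (p e).1
      have h8 := hdeg (p e).2
      have h9 : (H.filter (fun f => a f = a e)).card ≤
          (H.filter (fun f => a e ∈ ends f)).card :=
        Finset.card_le_card (Finset.monotone_filter_right _ fun f _ h =>
          (hmemab f _).2 (Or.inl h))
      have h10 : (H.filter (fun f => b f = b e)).card ≤
          (H.filter (fun f => b e ∈ ends f)).card :=
        Finset.card_le_card (Finset.monotone_filter_right _ fun f _ h =>
          (hmemab f _).2 (Or.inr h))
      rcases hab e with ⟨h, h'⟩ | ⟨h, h'⟩ <;> rw [h] at h9 ⊢ <;>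
        rw [h'] at h10 ⊢ <;> omega)
  have hRH : ∀ e, e ∉ H → e ∈ R := fun e he => by simpa [H, R] using he
  have hφL : ∀ e ∈ H, φ e ∈ L' e ∧ ∀ f ∈ R, adj e f → φ e ≠ ψ f := by
    intro e he
    have h := Finset.mem_sdiff.1 (hφ e he)
    exact ⟨h.1, fun f hf hef heq =>
      h.2 (Finset.mem_image.2 ⟨f, Finset.mem_filter.2 ⟨hf, hef⟩, heq.symm⟩)⟩
  refine ⟨fun e => if e ∈ H then φ e else ψ e, fun e => ?_, fun e f hef hadjef => ?_⟩
  · by_cases he : e ∈ H <;> simp only [he, if_true, if_false]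
    · exact hL'sub e _ (hφL e he).1
    · exact hL'sub e _ (hψ e (hRH e he))
  · by_cases he : e ∈ H <;> by_cases hf : f ∈ H <;> simp only [he, hf, if_true, if_false]
    · refine hφprop e he f hf hef ?_
      obtain ⟨x, hxe, hxf⟩ := hadjef
      rcases (hmemab e x).1 hxe with h | h <;> rcases (hmemab f x).1 hxf with h' | h'
      · exact Or.inl (h.trans h'.symm)
      · have h1 := hσa e he
        have h2 := hσb f hf
        rw [h] at h1; rw [h'] at h2
        exact absurd (h1.symm.trans h2) (by simp)
      · have h1 := hσb e he
        have h2 := hσa f hf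
        rw [h] at h1; rw [h'] at h2
        exact absurd (h1.symm.trans h2) (by simp)
      · exact Or.inr (h.trans h'.symm)
    · exact (hφL e he).2 f (hRH f hf) hadjef
    · obtain ⟨x, hxe, hxf⟩ := hadjef
      exact ((hφL f hf).2 e (hRH e he) ⟨x, hxf, hxe⟩).symm
    · exact hψprop e (hRH e he) f (hRH f hf) hef hadjef
end

section
/- Let G be a finite loopless multigraph and L : E(G) → 2^ℕ a list assignment on the edges of G. If |f(x,L)| ≥ deg(x) + μ(x) for every vertex x of G, then G admits a proper L-edge-coloring. -/
/-- `μ(x,y)`: the number of edges between `x` and `y`. -/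
noncomputable def edgeMultiplicity {V E : Type} (ends : E → Sym2 V) (x y : V) : ℕ :=
  Nat.card {e : E // ends e = s(x, y)}

/-- `μ(x) = max_z μ(x,z)`: the maximum edgeMultiplicity at `x`. -/
noncomputable def maxMultiplicity {V E : Type} [Fintype V] (ends : E → Sym2 V) (x : V) : ℕ :=
  Finset.univ.sup (fun z : V => edgeMultiplicity ends x z)

namespace LocalVizing

open Relation Function

variable {V E : Type}

/-- A proper partial edge-coloring in which the color of every edge belongs to the palette
of at least one of its endpoints. -/
structure IsPartialColoring (ends : E → Sym2 V) (F : V → Finset ℕ) (φ : E → Option ℕ) :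
    Prop where
  allowed : ∀ e c, φ e = some c → ∃ v ∈ ends e, c ∈ F v
  proper : ∀ e f c v, φ e = some c → φ f = some c → v ∈ ends e → v ∈ ends f → e = f

open Classical in
/-- The cost of giving the edge `e` the (possibly absent) color `o`. -/
noncomputable def edgeCost (ends : E → Sym2 V) (F : V → Finset ℕ) (e : E) : Option ℕ → ℕ
  | none => 2
  | some c => if ∀ v ∈ ends e, c ∈ F v then 0 else 1

/-- The total cost of a partial coloring. -/
noncomputable def cost [Fintype E] (ends : E → Sym2 V) (F : V → Finset ℕ)
    (φ : E → Option ℕ) : ℕ :=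
  ∑ e, edgeCost ends F e (φ e)

/-- A partial coloring of minimum cost. -/
def IsOptimal [Fintype E] (ends : E → Sym2 V) (F : V → Finset ℕ) (φ : E → Option ℕ) : Prop :=
  IsPartialColoring ends F φ ∧ ∀ ψ, IsPartialColoring ends F ψ → cost ends F φ ≤ cost ends F ψ

/-- The color `c` lies in the palette of `v` and is not used at `v`. -/
def Missing (ends : E → Sym2 V) (F : V → Finset ℕ) (φ : E → Option ℕ) (v : V) (c : ℕ) : Prop :=
  c ∈ F v ∧ ∀ e, v ∈ ends e → φ e ≠ some c

/-- Adjacency through an edge colored `a` or `b`. -/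
def KempeAdj (ends : E → Sym2 V) (φ : E → Option ℕ) (a b : ℕ) (s t : V) : Prop :=
  ∃ g, ends g = s(s, t) ∧ (φ g = some a ∨ φ g = some b)

/-- The step relation of a fan at `x`: some edge from `x` to `t` has a color missing at `s`. -/
def FanStep (ends : E → Sym2 V) (F : V → Finset ℕ) (φ : E → Option ℕ) (x s t : V) : Prop :=
  ∃ g c, ends g = s(x, t) ∧ φ g = some c ∧ Missing ends F φ s c

open Classical in
/-- Color `e` with `a` and uncolor `g`. -/
noncomputable def shift (φ : E → Option ℕ) (e g : E) (a : ℕ) : E → Option ℕ :=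
  update (update φ e (some a)) g none

lemma shift_right (φ : E → Option ℕ) (e g : E) (a : ℕ) : shift φ e g a g = none := by
  simp [shift]

lemma shift_eq_some {φ : E → Option ℕ} {e g : E} {a : ℕ} {f : E} {c : ℕ}
    (h : shift φ e g a f = some c) : f ≠ g ∧ ((f = e ∧ c = a) ∨ (f ≠ e ∧ φ f = some c)) := by
  classical
  unfold shift at h
  by_cases h1 : f = g
  · subst h1; simp at h
  · rw [update_of_ne h1] at h
    by_cases h2 : f = e
    · subst h2; simp at h; simp [h1, h]
    · rw [update_of_ne h2] at h; simp [h1, h2, h]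

lemma KempeAdj.symm {ends : E → Sym2 V} {φ : E → Option ℕ} {a b : ℕ} {s t : V}
    (h : KempeAdj ends φ a b s t) : KempeAdj ends φ a b t s := by
  obtain ⟨g, hg, hc⟩ := h
  exact ⟨g, by rw [hg, Sym2.eq_swap], hc⟩

lemma KempeAdj.color_swap {ends : E → Sym2 V} {φ : E → Option ℕ} {a b : ℕ} {s t : V}
    (h : KempeAdj ends φ a b s t) : KempeAdj ends φ b a s t := by
  obtain ⟨g, hg, hc⟩ := h
  exact ⟨g, hg, hc.symm⟩

lemma kempe_connected_symm {ends : E → Sym2 V} {φ : E → Option ℕ} {a b : ℕ} {s t : V}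
    (h : ReflTransGen (KempeAdj ends φ a b) s t) : ReflTransGen (KempeAdj ends φ a b) t s :=
  haveI : Std.Symm (KempeAdj ends φ a b) := ⟨fun _ _ => KempeAdj.symm⟩
  Std.Symm.symm _ _ h

section Optimal

variable [Fintype E] {ends : E → Sym2 V} {F : V → Finset ℕ} {φ : E → Option ℕ}

open Classical in
lemma cost_update (e : E) (o : Option ℕ) :
    cost ends F (update φ e o) + edgeCost ends F e (φ e) =
      cost ends F φ + edgeCost ends F e o := by
  unfold cost
  rw [← Finset.add_sum_erase _ _ (Finset.mem_univ e),
    ← Finset.add_sum_erase (a := e) _ (fun i => edgeCost ends F i (φ i)) (Finset.mem_univ e)]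
  have : ∑ i ∈ Finset.univ.erase e, edgeCost ends F i (update φ e o i) =
      ∑ i ∈ Finset.univ.erase e, edgeCost ends F i (φ i) :=
    Finset.sum_congr rfl fun i hi => by rw [update_of_ne (Finset.ne_of_mem_erase hi)]
  rw [this, update_self]
  omega

lemma exists_isOptimal (ends : E → Sym2 V) (F : V → Finset ℕ) : ∃ φ, IsOptimal ends F φ := by
  have h0 : {φ | IsPartialColoring ends F φ}.Nonempty :=
    ⟨fun _ => none, by constructor <;> simp⟩
  refine ⟨argminOn (cost ends F) _ h0, argminOn_mem _ _ h0, fun ψ hψ => ?_⟩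
  exact argminOn_le (cost ends F) _ hψ

lemma IsOptimal.exists_colored (h : IsOptimal ends F φ) {e : E} {u v : V} {a : ℕ}
    (he : φ e = none) (hends : ends e = s(u, v)) (hu : Missing ends F φ u a) :
    ∃ g, v ∈ ends g ∧ φ g = some a := by
  classical
  by_contra! hcon
  have hp : IsPartialColoring ends F (update φ e (some a)) := by
    have key : ∀ f z, f ≠ e → z ∈ ends e → z ∈ ends f → φ f ≠ some a := by
      intro f z hf hz hzf
      rw [hends, Sym2.mem_iff] at hz
      rcases hz with rfl | rfl
      · exact hu.2 f hzf
      · exact hcon f hzf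
    constructor
    · intro f c hf
      by_cases hfe : f = e
      · subst hfe
        simp only [update_self, Option.some.injEq] at hf
        subst hf
        exact ⟨u, by simp [hends], hu.1⟩
      · rw [update_of_ne hfe] at hf
        exact h.1.allowed f c hf
    · intro f f' c z hf hf' hz hz'
      by_cases h1 : f = e <;> by_cases h2 : f' = e
      · rw [h1, h2]
      · subst h1
        rw [update_self] at hf
        rw [update_of_ne h2] at hf'
        exact absurd (hf'.trans hf.symm) (key f' z h2 hz hz')
      · subst h2
        rw [update_self] at hf'
        rw [update_of_ne h1] at hf
        exact absurd (hf.trans hf'.symm) (key f z h1 hz' hz)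
      · rw [update_of_ne h1] at hf
        rw [update_of_ne h2] at hf'
        exact h.1.proper f f' c z hf hf' hz hz'
  have h1 := h.2 _ hp
  have h2 := cost_update (ends := ends) (F := F) (φ := φ) e (some a)
  have h3 : edgeCost ends F e (some a) ≤ 1 := by
    simp only [edgeCost]; split_ifs <;> simp
  have h4 : edgeCost ends F e (φ e) = 2 := by rw [he]; rfl
  omega

omit [Fintype E] in
lemma isPartialColoring_shift (h : IsPartialColoring ends F φ) {e g : E} {u v w : V} {a : ℕ}
    (hends : ends e = s(u, v)) (hu : Missing ends F φ u a)
    (hg : ends g = s(v, w)) (hga : φ g = some a) :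
    IsPartialColoring ends F (shift φ e g a) := by
  have key : ∀ f z, f ≠ g → z ∈ ends e → z ∈ ends f → φ f ≠ some a := by
    intro f z hf hz hzf hfa
    rw [hends, Sym2.mem_iff] at hz
    rcases hz with rfl | rfl
    · exact hu.2 f hzf hfa
    · exact hf (h.proper f g a z hfa hga hzf (by simp [hg]))
  constructor
  · intro f c hf
    rcases (shift_eq_some hf).2 with ⟨rfl, rfl⟩ | ⟨-, hf⟩
    · exact ⟨u, by simp [hends], hu.1⟩
    · exact h.allowed f c hf
  · intro f f' c z hf hf' hz hz'
    obtain ⟨hfg, hc⟩ := shift_eq_some hf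
    obtain ⟨hfg', hc'⟩ := shift_eq_some hf'
    rcases hc with ⟨rfl, rfl⟩ | ⟨-, hc⟩ <;> rcases hc' with ⟨rfl, h2⟩ | ⟨-, hc'⟩
    · rfl
    · exact absurd hc' (key f' z hfg' hz hz')
    · exact absurd (h2 ▸ hc) (key f z hfg hz' hz)
    · exact h.proper f f' c z hc hc' hz hz'

lemma IsOptimal.shift (h : IsOptimal ends F φ) {e g : E} {u v w : V} {a : ℕ}
    (he : φ e = none) (hends : ends e = s(u, v)) (hu : Missing ends F φ u a)
    (hg : ends g = s(v, w)) (hga : φ g = some a) :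
    IsOptimal ends F (shift φ e g a) ∧ a ∈ F w := by
  classical
  have hp := isPartialColoring_shift h.1 hends hu hg hga
  have hge : g ≠ e := by rintro rfl; simp [he] at hga
  have h1 := cost_update (ends := ends) (F := F) (φ := φ) e (some a)
  have h2 := cost_update (ends := ends) (F := F) (φ := update φ e (some a)) g none
  rw [update_of_ne hge, hga] at h2
  rw [he] at h1
  have h3 := h.2 _ hp
  change _ ≤ cost ends F (update (update φ e (some a)) g none) at h3
  have h4 : edgeCost ends F e none = 2 := rfl
  have h5 : edgeCost ends F g none = 2 := rfl
  have h6 : edgeCost ends F e (some a) = if a ∈ F v then 0 else 1 := by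
    simp [edgeCost, hends, hu.1]
  have h7 : edgeCost ends F g (some a) = if a ∈ F v ∧ a ∈ F w then 0 else 1 := by
    simp [edgeCost, hg]
  have h8 : a ∈ F v ∨ a ∈ F w := by
    obtain ⟨z, hz, hza⟩ := h.1.allowed g a hga
    rw [hg, Sym2.mem_iff] at hz
    rcases hz with rfl | rfl <;> simp [hza]
  have h9 : cost ends F (LocalVizing.shift φ e g a) ≤ cost ends F φ := by
    change cost ends F (update (update φ e (some a)) g none) ≤ _
    split_ifs at h6 h7 <;> first | omega | tauto
  refine ⟨⟨hp, fun ψ hψ => h9.trans (h.2 ψ hψ)⟩, ?_⟩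
  by_contra hw
  have hv : a ∈ F v := h8.resolve_right hw
  simp only [hv, hw, and_false, if_true, if_false] at h6 h7
  omega

omit [Fintype E] in
lemma Missing.shift {e g : E} {a c : ℕ} {z : V} (h : Missing ends F φ z c)
    (hc : c = a → z ∉ ends e) : Missing ends F (shift φ e g a) z c := by
  refine ⟨h.1, fun f hz hf => ?_⟩
  rcases (shift_eq_some hf).2 with ⟨rfl, rfl⟩ | ⟨-, hf⟩
  · exact hc rfl hz
  · exact h.2 f hz hf

/-- In an optimal coloring, the Kempe chain starting at one end of an uncolored edge ends
at the other end. -/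
lemma IsOptimal.kempe_connected [Finite V] (hloop : ∀ e, ¬ (ends e).IsDiag) {e : E} {u v : V}
    {a b : ℕ} (h : IsOptimal ends F φ) (he : φ e = none) (hends : ends e = s(u, v))
    (hu : Missing ends F φ u a) (hv : Missing ends F φ v b) :
    ReflTransGen (KempeAdj ends φ a b) v u := by
  induction hn : {z | ReflTransGen (KempeAdj ends φ a b) v z}.ncard using Nat.strong_induction_on
    generalizing φ e u v a b with
  | _ n ih =>
  by_contra hcon
  obtain ⟨g, hvg, hga⟩ := h.exists_colored he hends hu
  obtain ⟨w, hg⟩ := hvg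
  obtain ⟨hopt, haw⟩ := h.shift he hends hu hg hga
  have hwv : w ≠ v := by
    rintro rfl; exact hloop g (by simp [hg])
  have hba : b ≠ a := by
    rintro rfl; exact hv.2 g (by simp [hg]) hga
  have hw : Missing ends F (LocalVizing.shift φ e g a) w a := by
    refine ⟨haw, fun f hwf hf => ?_⟩
    obtain ⟨hfg, ⟨rfl, -⟩ | ⟨-, hf⟩⟩ := shift_eq_some hf
    · rw [hends, Sym2.mem_iff] at hwf
      rcases hwf with rfl | rfl
      · exact hu.2 g (by simp [hg]) hga
      · exact hwv rfl
    · exact hfg (h.1.proper f g a w hf hga hwf (by simp [hg]))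
  have hsub : ∀ z, ReflTransGen (KempeAdj ends (LocalVizing.shift φ e g a) b a) w z →
      ReflTransGen (KempeAdj ends φ a b) v z ∧ z ≠ v := by
    intro z hz
    induction hz with
    | refl => exact ⟨.single ⟨g, hg, .inl hga⟩, hwv⟩
    | @tail s t _ hst ihs =>
      obtain ⟨hs, hsv⟩ := ihs
      obtain ⟨f, hf, hfc⟩ := hst
      have hfe : f ≠ e := by
        rintro rfl
        have : s ∈ ends f := by simp [hf]
        rw [hends, Sym2.mem_iff] at this
        rcases this with rfl | rfl
        · exact hcon hs
        · exact hsv rfl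
      have hfg : f ≠ g := by
        rintro rfl
        simp [shift_right] at hfc
      have hfc' : φ f = some a ∨ φ f = some b := by
        rcases hfc with hfc | hfc
        · rcases (shift_eq_some hfc).2 with ⟨h1, -⟩ | ⟨-, h1⟩
          · exact absurd h1 hfe
          · exact .inr h1
        · rcases (shift_eq_some hfc).2 with ⟨h1, -⟩ | ⟨-, h1⟩
          · exact absurd h1 hfe
          · exact .inl h1
      refine ⟨hs.tail ⟨f, hf, hfc'⟩, ?_⟩
      rintro rfl
      have htf : t ∈ ends f := by simp [hf]
      rcases hfc' with hfc' | hfc'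
      · exact hfg (h.1.proper f g a t hfc' hga htf (by simp [hg]))
      · exact hv.2 f htf hfc'
  have hlt : {z | ReflTransGen (KempeAdj ends (LocalVizing.shift φ e g a) b a) w z}.ncard < n := by
    rw [← hn]
    refine Set.ncard_lt_ncard ⟨fun z hz => (hsub z hz).1, fun hle => ?_⟩
    exact (hsub v (hle ReflTransGen.refl)).2 rfl
  have := ih _ hlt hopt (shift_right φ e g a) hg (hv.shift fun hba' => absurd hba' hba) hw rfl
  exact (hsub v this).2 rfl

/-- In an optimal coloring, the Kempe chain starting at the last vertex of a fan path without
repeated vertices ends at the center of the fan. -/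
lemma IsOptimal.kempe_connected_of_chain [Finite V] (hloop : ∀ e, ¬ (ends e).IsDiag)
    (h : IsOptimal ends F φ) {e : E} {x y : V} {a b : ℕ} (l : List V) (he : φ e = none)
    (hends : ends e = s(x, y)) (hx : Missing ends F φ x a) (hnd : (y :: l).Nodup)
    (hl : (y :: l).IsChain (FanStep ends F φ x))
    (hz : Missing ends F φ ((y :: l).getLast (by simp)) b) :
    ReflTransGen (KempeAdj ends φ a b) ((y :: l).getLast (by simp)) x := by
  induction l generalizing φ e y with
  | nil => exact h.kempe_connected hloop he hends hx hz
  | cons y' l ih =>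
    rw [List.getLast_cons (by simp)] at hz ⊢
    set z := (y' :: l).getLast (by simp)
    have hzmem : z ∈ y' :: l := List.getLast_mem _
    by_cases hzx : z = x
    · rw [hzx]
    obtain ⟨hstep, hl'⟩ := List.isChain_cons_cons.1 hl
    obtain ⟨g, c, hg, hgc, hyc⟩ := hstep
    have hends' : ends e = s(y, x) := by rw [hends, Sym2.eq_swap]
    obtain ⟨hopt, -⟩ := h.shift he hends' hyc hg hgc
    have hac : a ≠ c := by
      rintro rfl; exact hx.2 g (by simp [hg]) hgc
    have hy : ∀ s ∈ y' :: l, s ≠ y := by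
      rintro s hs rfl; exact (List.nodup_cons.1 hnd).1 hs
    have hmiss : ∀ s ∈ y' :: l, s ≠ x → ∀ d, Missing ends F φ s d →
        Missing ends F (LocalVizing.shift φ e g c) s d := by
      intro s hs hsx d hd
      refine hd.shift fun _ hse => ?_
      rw [hends, Sym2.mem_iff] at hse
      exact hse.elim hsx (hy s hs)
    have hx' : Missing ends F (LocalVizing.shift φ e g c) x a :=
      hx.shift fun hac' => absurd hac' hac
    have hchain : (y' :: l).IsChain (FanStep ends F (LocalVizing.shift φ e g c) x) := by
      refine hl'.imp_of_mem_tail_imp fun s t hs ht hst => ?_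
      obtain ⟨f, d, hf, hfd, hsd⟩ := hst
      have hsx : s ≠ x := by
        rintro rfl; exact hsd.2 f (by simp [hf]) hfd
      have hfe : f ≠ e := by
        rintro rfl; simp [he] at hfd
      have hfg : f ≠ g := by
        rintro rfl
        obtain rfl : t = y' := Sym2.congr_right.1 (hf.symm.trans hg)
        exact (List.nodup_cons.1 (List.nodup_cons.1 hnd).2).1 ht
      exact ⟨f, d, hf, by simp [LocalVizing.shift, hfe, hfg, hfd], hmiss s hs hsx d hsd⟩
    have := ih hopt (shift_right φ e g c) hg hx' (List.nodup_cons.1 hnd).2 hchain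
      (hmiss z hzmem hzx b hz)
    refine ReflTransGen.lift' id (fun s t hst => ?_) _ _ this
    obtain ⟨f, hf, hfc⟩ := hst
    have hcases : ∀ d, LocalVizing.shift φ e g c f = some d → d = a ∨ d = b →
        ReflTransGen (KempeAdj ends φ a b) s t := by
      intro d hfd hd
      obtain ⟨-, ⟨rfl, rfl⟩ | ⟨-, h1⟩⟩ := shift_eq_some hfd
      · obtain rfl : d = b := hd.resolve_left (Ne.symm hac)
        have hyx := h.kempe_connected hloop he hends hx hyc
        rw [hf, Sym2.eq_iff] at hends
        rcases hends with ⟨rfl, rfl⟩ | ⟨rfl, rfl⟩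
        · exact kempe_connected_symm hyx
        · exact hyx
      · exact .single ⟨f, hf, by rcases hd with rfl | rfl <;> simp [h1]⟩
    exact hfc.elim (fun h1 => hcases a h1 (.inl rfl)) (fun h1 => hcases b h1 (.inr rfl))

lemma exists_nodup_isChain {α : Type} {r : α → α → Prop} {s t : α} (h : ReflTransGen r s t) :
    ∃ l : List α, (s :: l).Nodup ∧ (s :: l).IsChain r ∧ (s :: l).getLast (by simp) = t := by
  induction h using ReflTransGen.head_induction_on with
  | refl => exact ⟨[], by simp⟩
  | @head a b hab _ ih =>
    obtain ⟨l, hnd, hl, hlast⟩ := ih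
    by_cases ha : a ∈ b :: l
    · obtain ⟨l₁, l₂, hsplit⟩ := List.append_of_mem ha
      simp only [hsplit] at hnd hl hlast
      refine ⟨l₂, (List.nodup_append.1 hnd).2.1, hl.right_of_append, ?_⟩
      rw [← hlast, List.getLast_append_of_ne_nil _ (by simp)]
    · exact ⟨b :: l, List.nodup_cons.2 ⟨ha, hnd⟩, List.isChain_cons_cons.2 ⟨hab, hl⟩,
        by rwa [List.getLast_cons (by simp)]⟩

/-- In an optimal coloring, the Kempe chains starting at the vertices of a fan end at the
center of the fan. -/
lemma IsOptimal.kempe_connected_of_fan [Finite V] (hloop : ∀ e, ¬ (ends e).IsDiag)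
    (h : IsOptimal ends F φ) {e : E} {x y z : V} {a b : ℕ} (he : φ e = none)
    (hends : ends e = s(x, y)) (hx : Missing ends F φ x a)
    (hyz : ReflTransGen (FanStep ends F φ x) y z) (hz : Missing ends F φ z b) :
    ReflTransGen (KempeAdj ends φ a b) z x := by
  obtain ⟨l, hnd, hl, rfl⟩ := exists_nodup_isChain hyz
  exact h.kempe_connected_of_chain hloop l he hends hx hnd hl hz

end Optimal

/-- The vertex `z` is reached from `x` by `n` steps along edges colored `b, a, b, …`. -/
def AltReach (ends : E → Sym2 V) (φ : E → Option ℕ) (a b : ℕ) (x : V) : ℕ → V → Prop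
  | 0, z => z = x
  | n + 1, z => ∃ s, AltReach ends φ a b x n s ∧
      ∃ g, ends g = s(s, z) ∧ φ g = some (if Even n then b else a)

section Alternating

variable {ends : E → Sym2 V} {F : V → Finset ℕ} {φ : E → Option ℕ} {a b : ℕ} {x y z : V}

lemma IsPartialColoring.eq_of_color_eq (h : IsPartialColoring ends F φ) {s t t' : V} {c : ℕ}
    {g g' : E} (hg : ends g = s(s, t)) (hg' : ends g' = s(s, t')) (hc : φ g = some c)
    (hc' : φ g' = some c) : t = t' := by
  obtain rfl := h.proper g g' c s hc hc' (by simp [hg]) (by simp [hg'])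
  exact Sym2.congr_right.1 (hg.symm.trans hg')

lemma AltReach.unique (h : IsPartialColoring ends F φ) {n : ℕ}
    (hy : AltReach ends φ a b x n y) (hz : AltReach ends φ a b x n z) : y = z := by
  induction n generalizing y z with
  | zero => exact Eq.trans hy (Eq.symm hz)
  | succ n ih =>
    obtain ⟨s, hs, g, hg, hc⟩ := hy
    obtain ⟨s', hs', g', hg', hc'⟩ := hz
    obtain rfl := ih hs hs'
    exact h.eq_of_color_eq hg hg' hc hc'

lemma AltReach.exists_of_le {m n : ℕ} (hmn : m ≤ n) (h : AltReach ends φ a b x n z) :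
    ∃ s, AltReach ends φ a b x m s := by
  induction n, hmn using Nat.le_induction generalizing z with
  | base => exact ⟨z, h⟩
  | succ n _ ih =>
    obtain ⟨s, hs, -⟩ := h
    exact ih hs

lemma exists_altReach (h : IsPartialColoring ends F φ) (hx : Missing ends F φ x a)
    (hxz : ReflTransGen (KempeAdj ends φ a b) x z) : ∃ n, AltReach ends φ a b x n z := by
  induction hxz with
  | refl => exact ⟨0, rfl⟩
  | @tail s t _ hst ih =>
    obtain ⟨n, hn⟩ := ih
    obtain ⟨f, hf, hfc⟩ := hst
    obtain ⟨c, hc, hcab⟩ : ∃ c, φ f = some c ∧ (c = a ∨ c = b) := by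
      rcases hfc with hfc | hfc
      · exact ⟨a, hfc, .inl rfl⟩
      · exact ⟨b, hfc, .inr rfl⟩
    by_cases hcn : c = if Even n then b else a
    · exact ⟨n + 1, s, hn, f, hf, by rw [hc, hcn]⟩
    · cases n with
      | zero =>
        obtain rfl : s = x := hn
        rcases hcab with rfl | rfl
        · exact absurd hc (hx.2 f (by simp [hf]))
        · simp at hcn
      | succ n =>
        obtain ⟨r, hr, g, hg, hgc⟩ := hn
        have hc' : c = if Even n then b else a := by
          simp only [Nat.even_add_one] at hcn
          split_ifs at hcn ⊢ <;> tauto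
        rw [← hc'] at hgc
        obtain rfl := h.eq_of_color_eq (hg.trans Sym2.eq_swap) hf hgc hc
        exact ⟨n, hr⟩

lemma AltReach.not_missing (hx : x ≠ y) {m n : ℕ} (hmn : m < n)
    (h : IsPartialColoring ends F φ) (hy : AltReach ends φ a b x m y)
    (hz : AltReach ends φ a b x n z) : ¬ Missing ends F φ y b := by
  intro hmiss
  obtain ⟨t, s, hs, g, hg, hgc⟩ := hz.exists_of_le (Nat.succ_le_of_lt hmn)
  obtain rfl := hy.unique h hs
  cases m with
  | zero => exact hx (Eq.symm hy)
  | succ m =>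
    obtain ⟨r, hr, f, hf, hfc⟩ := hy
    simp only [Nat.even_add_one] at hgc
    by_cases hm : Even m
    · exact hmiss.2 f (by simp [hf]) (by simpa [hm] using hfc)
    · exact hmiss.2 g (by simp [hg]) (by simpa [hm] using hgc)

/-- A Kempe chain has at most one endpoint other than a given one. -/
lemma IsPartialColoring.kempe_endpoint_unique (h : IsPartialColoring ends F φ)
    (hx : Missing ends F φ x a) (hy : Missing ends F φ y b) (hz : Missing ends F φ z b)
    (hyx : y ≠ x) (hzx : z ≠ x) (hcy : ReflTransGen (KempeAdj ends φ a b) y x)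
    (hcz : ReflTransGen (KempeAdj ends φ a b) z x) : y = z := by
  obtain ⟨m, hm⟩ := exists_altReach h hx (kempe_connected_symm hcy)
  obtain ⟨n, hn⟩ := exists_altReach h hx (kempe_connected_symm hcz)
  rcases lt_trichotomy m n with hlt | rfl | hlt
  · exact absurd hy (AltReach.not_missing hyx.symm hlt h hm hn)
  · exact hm.unique h hn
  · exact absurd hz (AltReach.not_missing hzx.symm hlt h hn hm)

end Alternating

open Classical in
/-- The finset of colors missing at `v`. -/
noncomputable def missingFinset (ends : E → Sym2 V) (F : V → Finset ℕ) (φ : E → Option ℕ)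
    (v : V) : Finset ℕ :=
  {c ∈ F v | ∀ e, v ∈ ends e → φ e ≠ some c}

lemma mem_missingFinset {ends : E → Sym2 V} {F : V → Finset ℕ} {φ : E → Option ℕ} {v : V}
    {c : ℕ} :
    c ∈ missingFinset ends F φ v ↔ Missing ends F φ v c := by
  simp [missingFinset, Missing]

section Counting

variable [Fintype V] [Fintype E] {ends : E → Sym2 V} {F : V → Finset ℕ} {φ : E → Option ℕ}

omit [Fintype V] in
lemma card_le_multideg_add (v : V) :
    (F v).card ≤ multideg ends v + (missingFinset ends F φ v).card := by
  classical
  have hdeg : multideg ends v = (Finset.univ.filter fun e => v ∈ ends e).card := by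
    rw [multideg, Nat.card_eq_fintype_card, Fintype.card_subtype]
  have hsub : F v ⊆ ((Finset.univ.filter fun e => v ∈ ends e).image fun e => (φ e).getD 0) ∪
      missingFinset ends F φ v := by
    intro c hc
    by_cases h : ∃ e, v ∈ ends e ∧ φ e = some c
    · obtain ⟨e, he, hec⟩ := h
      exact Finset.mem_union_left _ (Finset.mem_image.2 ⟨e, by simp [he], by simp [hec]⟩)
    · push Not at h
      exact Finset.mem_union_right _ (mem_missingFinset.2 ⟨hc, h⟩)
  calc (F v).card ≤ _ := Finset.card_le_card hsub
    _ ≤ _ := Finset.card_union_le _ _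
    _ ≤ _ := by rw [hdeg]; gcongr; exact Finset.card_image_le

omit [Fintype E] in
lemma edgeMultiplicity_le_maxMultiplicity (x y : V) :
    edgeMultiplicity ends x y ≤ maxMultiplicity ends x :=
  Finset.le_sup (f := fun z => edgeMultiplicity ends x z) (Finset.mem_univ y)

lemma edgeMultiplicity_le_card_missingFinset
    (hF : ∀ v, multideg ends v + maxMultiplicity ends v ≤ (F v).card) (x y : V) :
    edgeMultiplicity ends x y ≤ (missingFinset ends F φ x).card := by
  have h1 := hF x
  have h2 := card_le_multideg_add (ends := ends) (F := F) (φ := φ) x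
  have h3 := edgeMultiplicity_le_maxMultiplicity (ends := ends) x y
  omega

/-- An optimal coloring is total when the palettes are large. -/
lemma IsOptimal.ne_none (hloop : ∀ e, ¬ (ends e).IsDiag)
    (hF : ∀ v, multideg ends v + maxMultiplicity ends v ≤ (F v).card)
    (h : IsOptimal ends F φ) (e : E) : φ e ≠ none := by
  classical
  intro he
  obtain ⟨x, y, hends⟩ : ∃ x y, ends e = s(x, y) := by
    induction hs : ends e with
    | _ x y => exact ⟨x, y, rfl⟩
  have hxy : x ≠ y := by
    rintro rfl; exact hloop e (by simp [hends])
  have hcard : ∀ s t, edgeMultiplicity ends s t =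
      (Finset.univ.filter fun g => ends g = s(s, t)).card := fun s t => by
    rw [edgeMultiplicity, Nat.card_eq_fintype_card, Fintype.card_subtype]
  obtain ⟨a, ha⟩ : ∃ a, Missing ends F φ x a := by
    have h1 := edgeMultiplicity_le_card_missingFinset (φ := φ) hF x y
    have h2 : 0 < edgeMultiplicity ends x y := by
      rw [hcard]; exact Finset.card_pos.2 ⟨e, by simp [hends]⟩
    obtain ⟨a, ha⟩ := Finset.card_pos.1 (h2.trans_le h1)
    exact ⟨a, mem_missingFinset.1 ha⟩
  let Y : Finset V := Finset.univ.filter fun z => ReflTransGen (FanStep ends F φ x) y z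
  have hY : ∀ z, z ∈ Y ↔ ReflTransGen (FanStep ends F φ x) y z := by simp [Y]
  have hYx : ∀ z ∈ Y, z ≠ x := by
    intro z hz
    rcases ((hY z).1 hz).cases_tail with rfl | ⟨s, -, g, c, hg, -⟩
    · exact hxy.symm
    · rintro rfl; exact hloop g (by simp [hg])
  have hconn : ∀ z ∈ Y, ∀ b, Missing ends F φ z b → ReflTransGen (KempeAdj ends φ a b) z x :=
    fun z hz b hb => h.kempe_connected_of_fan hloop he hends ha ((hY z).1 hz) hb
  let T : Finset E := Y.biUnion fun z => Finset.univ.filter fun g => ends g = s(x, z)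
  have hsub : Y.biUnion (missingFinset ends F φ) ⊆ (T.erase e).image fun g => (φ g).getD 0 := by
    intro b hb
    obtain ⟨z, hz, hzb⟩ := Finset.mem_biUnion.1 hb
    rw [mem_missingFinset] at hzb
    obtain ⟨t, g, hg, hgb⟩ : ∃ t g, ends g = s(x, t) ∧ φ g = some b := by
      rcases (hconn z hz b hzb).cases_tail with hzx | ⟨t, -, g, hg, hgc⟩
      · exact absurd hzx.symm (hYx z hz)
      · refine ⟨t, g, hg.trans Sym2.eq_swap, hgc.resolve_left (ha.2 g (by simp [hg]))⟩
    have ht : t ∈ Y := (hY t).2 (((hY z).1 hz).tail ⟨g, b, hg, hgb, hzb⟩)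
    refine Finset.mem_image.2 ⟨g, Finset.mem_erase.2 ⟨?_, ?_⟩, by simp [hgb]⟩
    · rintro rfl; simp [he] at hgb
    · exact Finset.mem_biUnion.2 ⟨t, ht, by simp [hg]⟩
  have hdisj : (Y : Set V).PairwiseDisjoint (missingFinset ends F φ) := by
    intro z hz z' hz' hne
    refine Finset.disjoint_left.2 fun b hb hb' => hne ?_
    rw [mem_missingFinset] at hb hb'
    exact h.1.kempe_endpoint_unique ha hb hb' (hYx z hz) (hYx z' hz') (hconn z hz b hb)
      (hconn z' hz' b hb')
  have heT : e ∈ T := Finset.mem_biUnion.2 ⟨y, (hY y).2 .refl, by simp [hends]⟩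
  have h1 : ∑ z ∈ Y, (missingFinset ends F φ z).card ≤ (T.erase e).card := by
    rw [← Finset.card_biUnion hdisj]
    exact (Finset.card_le_card hsub).trans Finset.card_image_le
  have h2 : T.card ≤ ∑ z ∈ Y, (missingFinset ends F φ z).card := by
    refine Finset.card_biUnion_le.trans (Finset.sum_le_sum fun z _ => ?_)
    rw [Sym2.eq_swap, ← hcard]
    exact edgeMultiplicity_le_card_missingFinset hF z x
  have h3 := Finset.card_erase_lt_of_mem heT
  omega

end Counting

end LocalVizing

/-- **Local Vizing theorem for lists.** If `G` is a finite loopless multigraph and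
`L` is a list assignment on its edges with `|f(x,L)| ≥ deg(x) + μ(x)` for every
vertex `x`, then `G` admits a proper `L`-edge-coloring. -/
theorem local_vizing_list_edge_coloring {V E : Type} [Fintype V] [Fintype E]
    (ends : E → Sym2 V) (hloopless : ∀ e : E, ¬ (ends e).IsDiag)
    (L : E → Set ℕ)
    (hf : ∀ x : V,
      ((multideg ends x + maxMultiplicity ends x : ℕ) : ℕ∞) ≤ (listInter ends L x).encard) :
    ∃ φ : E → ℕ, IsProperLEdgeColoring ends L φ := by
  have hsub : ∀ x, ∃ S : Finset ℕ, (S : Set ℕ) ⊆ listInter ends L x ∧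
      S.card = multideg ends x + maxMultiplicity ends x := by
    intro x
    obtain ⟨t, ht, htc⟩ := Set.exists_subset_encard_eq (hf x)
    have hfin : t.Finite := Set.finite_of_encard_eq_coe htc
    refine ⟨hfin.toFinset, by simpa using ht, ?_⟩
    rw [hfin.encard_eq_coe_toFinset_card] at htc
    exact_mod_cast htc
  choose F hFL hF using hsub
  obtain ⟨φ, hφ⟩ := LocalVizing.exists_isOptimal ends F
  have hsome : ∀ e, ∃ c, φ e = some c := fun e =>
    Option.ne_none_iff_exists'.1 (hφ.ne_none hloopless (fun v => (hF v).ge) e)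
  choose ψ hψ using hsome
  refine ⟨ψ, fun e => ?_, fun e f hef ⟨v, hve, hvf⟩ hc => ?_⟩
  · obtain ⟨v, hv, hc⟩ := hφ.1.allowed e _ (hψ e)
    exact hFL v hc e hv
  · exact hef (hφ.1.proper e f (ψ e) v (hψ e) (hc ▸ hψ f) hve hvf)
end

section
/- Let G be a finite loopless bipartite multigraph and L : E(G) → 2^ℕ a list assignment on the edges of G. If |f(x,L)| ≥ deg(x) for every vertex x of G, then G admits a proper L-edge-coloring. -/
/-- A multigraph is bipartite if there is a set `A` of vertices such that every edge
has exactly one endpoint in `A`. -/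
def IsBipartiteMultigraph {V E : Type} (ends : E → Sym2 V) : Prop :=
  ∃ A : Set V, ∀ e : E, ∃ a b : V, ends e = s(a, b) ∧ a ∈ A ∧ b ∉ A

open Finset

section BipartiteListColoring

variable {E A B : Type}

/-- The edges of `S` that have the same end as `e` under `p` and a smaller rank. -/
def betterEdges [DecidableEq A] (p : E → A) (r : E → ℕ) (S : Finset E) (e : E) : Finset E :=
  {f ∈ S | p f = p e ∧ r f < r e}

/-- The number of edges of `S` whose end under `p` is `a`. -/
def sideDegree [DecidableEq A] (p : E → A) (S : Finset E) (a : A) : ℕ :=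
  #{f ∈ S | p f = a}

/-- The rank `r` strictly orders the edges of `S` at each vertex of the side given by `p`. -/
def IsStrictRank (p : E → A) (r : E → ℕ) (S : Finset E) : Prop :=
  ∀ e ∈ S, ∀ f ∈ S, p e = p f → r e = r f → e = f

/-- Every edge of `S` has fewer better edges, at both ends together, than the larger of the
degrees of its ends. -/
def IsGoodRanking [DecidableEq A] [DecidableEq B] (p : E → A) (q : E → B)
    (S : Finset E) (r s : E → ℕ) : Prop :=
  IsStrictRank p r S ∧ IsStrictRank q s S ∧
    ∀ e ∈ S, #(betterEdges p r S e) + #(betterEdges q s S e) <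
      max (sideDegree p S (p e)) (sideDegree q S (q e))

lemma IsGoodRanking.swap [DecidableEq A] [DecidableEq B] {p : E → A} {q : E → B}
    {S : Finset E} {r s : E → ℕ}
    (h : IsGoodRanking p q S r s) : IsGoodRanking q p S s r :=
  ⟨h.2.1, h.1, fun e he => by rw [add_comm, max_comm]; exact h.2.2 e he⟩

lemma IsStrictRank.mono {p : E → A} {r : E → ℕ} {S T : Finset E} (h : IsStrictRank p r S)
    (hT : T ⊆ S) : IsStrictRank p r T :=
  fun e he f hf => h e (hT he) f (hT hf)

/-- Existence of stable matchings in bipartite multigraphs. -/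
lemma exists_stable_matching_s2 [DecidableEq E] [DecidableEq A] [DecidableEq B]
    (p : E → A) (q : E → B) (r s : E → ℕ) (T : Finset E)
    (hr : IsStrictRank p r T) (hs : IsStrictRank q s T) :
    ∃ M ⊆ T, (∀ e ∈ M, ∀ f ∈ M, p e = p f ∨ q e = q f → e = f) ∧
      ∀ e ∈ T, e ∉ M → ∃ f ∈ M, (p f = p e ∧ r f < r e) ∨ (q f = q e ∧ s f < s e) := by
  induction T using Finset.strongInduction with
  | H T ih =>
    by_cases h : ∃ e ∈ T, ∃ f ∈ T, (∀ g ∈ T, p g = p e → r e ≤ r g) ∧ q e = q f ∧ s e < s f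
    · obtain ⟨e, he, f, hf, htop, hq, hlt⟩ := h
      obtain ⟨M, hMT, hM, hdom⟩ := ih (T.erase f) (erase_ssubset hf)
        (hr.mono (erase_subset _ _)) (hs.mono (erase_subset _ _))
      refine ⟨M, hMT.trans (erase_subset _ _), hM, fun x hx hxM => ?_⟩
      by_cases hxf : x = f
      · subst hxf
        by_cases heM : e ∈ M
        · exact ⟨e, heM, Or.inr ⟨hq, hlt⟩⟩
        · have hex : e ≠ x := by rintro rfl; exact lt_irrefl _ hlt
          obtain ⟨g, hg, h1 | h1⟩ := hdom e (mem_erase.2 ⟨hex, he⟩) heM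
          · exact absurd (htop g (mem_of_mem_erase (hMT hg)) h1.1) (not_le.2 h1.2)
          · exact ⟨g, hg, Or.inr ⟨h1.1.trans hq, h1.2.trans hlt⟩⟩
      · exact hdom x (mem_erase.2 ⟨hxf, hx⟩) hxM
    · push Not at h
      refine ⟨{e ∈ T | ∀ g ∈ T, p g = p e → r e ≤ r g}, filter_subset _ _, ?_, ?_⟩
      · intro e he f hf hef
        rw [mem_filter] at he hf
        rcases hef with hp | hq
        · exact hr e he.1 f hf.1 hp
            (le_antisymm (he.2 f hf.1 hp.symm) (hf.2 e he.1 hp))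
        · exact hs e he.1 f hf.1 hq
            (le_antisymm (h f hf.1 e he.1 hf.2 hq.symm) (h e he.1 f hf.1 he.2 hq))
      · intro e he heM
        obtain ⟨m, hm, hmin⟩ := exists_min_image {f ∈ T | p f = p e} r
          ⟨e, mem_filter.2 ⟨he, rfl⟩⟩
        rw [mem_filter] at hm
        refine ⟨m, mem_filter.2 ⟨hm.1, fun g hg hgm =>
          hmin g (mem_filter.2 ⟨hg, hgm.trans hm.2⟩)⟩, Or.inl ⟨hm.2, ?_⟩⟩
        by_contra hlt
        exact heM (mem_filter.2 ⟨he, fun g hg hge =>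
          (not_lt.1 hlt).trans (hmin g (mem_filter.2 ⟨hg, hge⟩))⟩)

lemma betterEdges_mono [DecidableEq A] (p : E → A) (r : E → ℕ) {S T : Finset E}
    (h : T ⊆ S) (e : E) :
    betterEdges p r T e ⊆ betterEdges p r S e :=
  filter_subset_filter _ h

lemma card_betterEdges_sdiff_lt [DecidableEq E] [DecidableEq A] {p : E → A} {r : E → ℕ}
    {S M : Finset E} {e f : E}
    (hf : f ∈ M) (hfS : f ∈ S) (hp : p f = p e) (hlt : r f < r e) :
    #(betterEdges p r (S \ M) e) < #(betterEdges p r S e) := by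
  refine card_lt_card (ssubset_iff_of_subset (betterEdges_mono p r sdiff_subset e) |>.2
    ⟨f, ?_, ?_⟩)
  · simp [betterEdges, *]
  · simp [betterEdges, *]

/-- Galvin's argument: edges can be colored from lists longer than their numbers of
better edges. -/
lemma exists_coloring_of_card_betterEdges_lt [DecidableEq E] [DecidableEq A] [DecidableEq B]
    (p : E → A) (q : E → B) (r s : E → ℕ)
    (S : Finset E) (L : E → Finset ℕ) (hr : IsStrictRank p r S) (hs : IsStrictRank q s S)
    (hL : ∀ e ∈ S, #(betterEdges p r S e) + #(betterEdges q s S e) < #(L e)) :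
    ∃ φ : E → ℕ, (∀ e ∈ S, φ e ∈ L e) ∧
      ∀ e ∈ S, ∀ f ∈ S, e ≠ f → (p e = p f ∨ q e = q f) → φ e ≠ φ f := by
  induction S using Finset.strongInduction generalizing L with
  | H S ih =>
    obtain rfl | ⟨e₀, he₀⟩ := S.eq_empty_or_nonempty
    · exact ⟨fun _ => 0, by simp, by simp⟩
    obtain ⟨c, hc⟩ := card_pos.1 (Nat.zero_lt_of_lt (hL e₀ he₀))
    have hsub : {e ∈ S | c ∈ L e} ⊆ S := filter_subset _ _
    obtain ⟨M, hMT, hM, hdom⟩ := exists_stable_matching_s2 p q r s {e ∈ S | c ∈ L e}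
      (hr.mono hsub) (hs.mono hsub)
    have hMS : M ⊆ S := hMT.trans hsub
    have hMne : M.Nonempty := by
      by_cases h : e₀ ∈ M
      · exact ⟨e₀, h⟩
      · obtain ⟨f, hf, -⟩ := hdom e₀ (mem_filter.2 ⟨he₀, hc⟩) h
        exact ⟨f, hf⟩
    obtain ⟨φ, hφL, hφ⟩ := ih (S \ M) (sdiff_ssubset hMS hMne) (fun e => (L e).erase c)
      (hr.mono sdiff_subset) (hs.mono sdiff_subset) (by
        intro e he
        rw [mem_sdiff] at he
        have h0 := hL e he.1
        have h1 := card_le_card (betterEdges_mono p r (sdiff_subset (s := S) (t := M)) e)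
        have h2 := card_le_card (betterEdges_mono q s (sdiff_subset (s := S) (t := M)) e)
        by_cases hce : c ∈ L e
        · have h3 := card_erase_add_one hce
          obtain ⟨f, hf, ⟨hp, hlt⟩ | ⟨hq, hlt⟩⟩ := hdom e (mem_filter.2 ⟨he.1, hce⟩) he.2
          · have := card_betterEdges_sdiff_lt hf (hMS hf) hp hlt
            omega
          · have := card_betterEdges_sdiff_lt hf (hMS hf) hq hlt
            omega
        · rw [erase_eq_of_notMem hce]
          omega)
    refine ⟨fun e => if e ∈ M then c else φ e, fun e he => ?_, fun e he f hf hne hadj => ?_⟩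
    · by_cases heM : e ∈ M
      · simpa [heM] using (mem_filter.1 (hMT heM)).2
      · simpa [heM] using mem_of_mem_erase (hφL e (mem_sdiff.2 ⟨he, heM⟩))
    · by_cases heM : e ∈ M <;> by_cases hfM : f ∈ M
      · exact absurd (hM e heM f hfM hadj) hne
      · simpa [heM, hfM] using (ne_of_mem_erase (hφL f (mem_sdiff.2 ⟨hf, hfM⟩))).symm
      · simpa [heM, hfM] using ne_of_mem_erase (hφL e (mem_sdiff.2 ⟨he, heM⟩))
      · simpa [heM, hfM] using
          hφ e (mem_sdiff.2 ⟨he, heM⟩) f (mem_sdiff.2 ⟨hf, hfM⟩) hne hadj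

/-- If the `q`-side is at most as large as the `p`-side, there is a nonempty matching such that
an uncovered neighbor of a covered vertex of the `p`-side has smaller degree. -/
lemma exists_degree_dominating_matching [DecidableEq E] [DecidableEq A] [DecidableEq B]
    (p : E → A) (q : E → B) (S : Finset E)
    (hS : S.Nonempty) (hcard : #(S.image q) ≤ #(S.image p)) :
    ∃ M ⊆ S, M.Nonempty ∧ Set.InjOn p M ∧ Set.InjOn q M ∧
      ∀ e ∈ S, p e ∈ M.image p → q e ∉ M.image q →
        sideDegree q S (q e) < sideDegree p S (p e) := by
  let N : Finset A → Finset B := fun Y =>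
    {e ∈ S | p e ∈ Y ∧ sideDegree p S (p e) ≤ sideDegree q S (q e)}.image q
  have hN : ∀ Y b, b ∈ N Y ↔
      ∃ e ∈ S, (p e ∈ Y ∧ sideDegree p S (p e) ≤ sideDegree q S (q e)) ∧ q e = b := by
    intro Y b
    simp [N, and_assoc]
  have hNmono : ∀ {Y Z : Finset A}, Y ⊆ Z → N Y ⊆ N Z := by
    intro Y Z hYZ b hb
    obtain ⟨e, he, ⟨h1, h2⟩, h3⟩ := (hN _ _).1 hb
    exact (hN _ _).2 ⟨e, he, ⟨hYZ h1, h2⟩, h3⟩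
  let F : Finset (Finset A) := {Y ∈ (S.image p).powerset | Y.Nonempty ∧ #(N Y) ≤ #Y}
  have hF : ∀ Y, Y ∈ F ↔ Y ⊆ S.image p ∧ Y.Nonempty ∧ #(N Y) ≤ #Y := by
    intro Y
    simp [F]
  have hFne : F.Nonempty := by
    refine ⟨S.image p, (hF _).2 ⟨subset_rfl, hS.image p, ?_⟩⟩
    exact (card_le_card (image_subset_image (filter_subset _ _))).trans hcard
  obtain ⟨Y, hY, hmin⟩ := exists_min_image F card hFne
  obtain ⟨hYS, ⟨a, ha⟩, hYN⟩ := (hF Y).1 hY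
  obtain hempty | hne := (N Y).eq_empty_or_nonempty
  · obtain ⟨e, he, rfl⟩ := mem_image.1 (hYS ha)
    refine ⟨{e}, by simpa using he, by simp, by simp, by simp, fun f hf hpf _ => ?_⟩
    by_contra hlt
    have : q f ∈ N Y :=
      (hN _ _).2 ⟨f, hf, ⟨by simp at hpf; rwa [hpf], not_lt.1 hlt⟩, rfl⟩
    simp [hempty] at this
  have hlow : ∀ Z ⊆ Y, #Z ≤ #(N Z) := by
    intro Z hZ
    by_contra! hlt
    have hZne : Z.Nonempty := card_pos.1 (Nat.zero_lt_of_lt hlt)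
    have hYZ := hmin Z ((hF Z).2 ⟨hZ.trans hYS, hZne, hlt.le⟩)
    obtain rfl := eq_of_subset_of_card_le hZ hYZ
    have h1 := card_erase_add_one ha
    have h2 := card_le_card (hNmono (erase_subset a Z))
    have h3 := hne.card_pos
    have := hmin (Z.erase a) ((hF _).2 ⟨(erase_subset _ _).trans hYS,
      card_pos.1 (by omega), by omega⟩)
    omega
  obtain ⟨σ, hσ, hσN⟩ := (all_card_le_biUnion_card_iff_exists_injective
    (fun a : Y => N {(a : A)})).1 (by
      intro Z
      have h1 := hlow (Z.map (Function.Embedding.subtype _)) (by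
        intro x hx
        obtain ⟨y, -, rfl⟩ := mem_map.1 hx
        exact y.2)
      rw [card_map] at h1
      refine h1.trans (card_le_card fun b hb => ?_)
      obtain ⟨e, he, ⟨h1, h2⟩, h3⟩ := (hN _ _).1 hb
      obtain ⟨y, hy, hye⟩ := mem_map.1 h1
      exact mem_biUnion.2 ⟨y, hy, (hN _ _).2 ⟨e, he, ⟨mem_singleton.2 hye.symm, h2⟩, h3⟩⟩)
  have hedge : ∀ y : Y, ∃ e ∈ S, p e = y ∧ q e = σ y := by
    intro y
    obtain ⟨e, he, ⟨h1, -⟩, h3⟩ := (hN _ _).1 (hσN y)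
    exact ⟨e, he, mem_singleton.1 h1, h3⟩
  choose g hgS hgp hgq using hedge
  have himg : univ.image σ = N Y := by
    refine eq_of_subset_of_card_le (fun b hb => ?_) ?_
    · obtain ⟨y, -, rfl⟩ := mem_image.1 hb
      exact hNmono (singleton_subset_iff.2 y.2) (hσN y)
    · rw [card_image_of_injective _ hσ]
      simpa using hYN
  refine ⟨univ.image g, ?_, ⟨g ⟨a, ha⟩, by simp⟩, ?_, ?_, ?_⟩
  · intro e he
    obtain ⟨y, -, rfl⟩ := mem_image.1 he
    exact hgS y
  · intro e he f hf hef
    obtain ⟨y, -, rfl⟩ := mem_image.1 he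
    obtain ⟨z, -, rfl⟩ := mem_image.1 hf
    rw [hgp, hgp] at hef
    rw [Subtype.ext hef]
  · intro e he f hf hef
    obtain ⟨y, -, rfl⟩ := mem_image.1 he
    obtain ⟨z, -, rfl⟩ := mem_image.1 hf
    rw [hgq, hgq] at hef
    rw [hσ hef]
  · intro e he hpe hqe
    by_contra! hle
    apply hqe
    obtain ⟨x, hx, hxe⟩ := mem_image.1 hpe
    obtain ⟨y, -, rfl⟩ := mem_image.1 hx
    have : q e ∈ N Y := (hN _ _).2 ⟨e, he, ⟨by rw [← hxe, hgp]; exact y.2, hle⟩, rfl⟩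
    rw [← himg] at this
    obtain ⟨z, -, hz⟩ := mem_image.1 this
    exact mem_image.2 ⟨g z, by simp, by rw [hgq, hz]⟩

lemma sideDegree_sdiff_add_one_le [DecidableEq E] [DecidableEq A] {p : E → A}
    {S M : Finset E} (hMS : M ⊆ S) {a : A}
    (ha : a ∈ M.image p) : sideDegree p (S \ M) a + 1 ≤ sideDegree p S a := by
  obtain ⟨f, hf, rfl⟩ := mem_image.1 ha
  refine Nat.succ_le_of_lt (card_lt_card (ssubset_iff_of_subset
    (filter_subset_filter _ sdiff_subset) |>.2 ⟨f, ?_, ?_⟩))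
  · simp [hMS hf]
  · simp [hf]

lemma sideDegree_mono [DecidableEq A] (p : E → A) {S T : Finset E} (h : T ⊆ S) (a : A) :
    sideDegree p T a ≤ sideDegree p S a :=
  card_le_card (filter_subset_filter _ h)

/-- A good ranking of `S \ M` extends to `S` by putting the edges of `M` first on the `p`-side
and last on the `q`-side. -/
lemma IsGoodRanking.extend [DecidableEq E] [DecidableEq A] [DecidableEq B]
    {p : E → A} {q : E → B} {S M : Finset E} {r s : E → ℕ}
    (h : IsGoodRanking p q (S \ M) r s) (hMS : M ⊆ S) (hp : Set.InjOn p M)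
    (hq : Set.InjOn q M)
    (hM : ∀ e ∈ S, p e ∈ M.image p → q e ∉ M.image q →
        sideDegree q S (q e) < sideDegree p S (p e)) :
    ∃ r' s' : E → ℕ, IsGoodRanking p q S r' s' := by
  obtain ⟨hr, hs, hb⟩ := h
  have hK : ∀ e ∈ S, s e < S.sup s + 1 := fun e he => Nat.lt_succ_of_le (le_sup he)
  refine ⟨fun e => if e ∈ M then 0 else r e + 1, fun e => if e ∈ M then S.sup s + 1 else s e,
    ?_, ?_, ?_⟩
  · intro e he f hf hef hrank
    by_cases heM : e ∈ M <;> by_cases hfM : f ∈ M <;> simp [heM, hfM] at hrank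
    · exact hp heM hfM hef
    · exact hr e (mem_sdiff.2 ⟨he, heM⟩) f (mem_sdiff.2 ⟨hf, hfM⟩) hef hrank
  · intro e he f hf hef hrank
    have h1 := hK e he
    have h2 := hK f hf
    by_cases heM : e ∈ M <;> by_cases hfM : f ∈ M <;>
      simp only [heM, hfM, if_true, if_false] at hrank
    · exact hq heM hfM hef
    · omega
    · omega
    · exact hs e (mem_sdiff.2 ⟨he, heM⟩) f (mem_sdiff.2 ⟨hf, hfM⟩) hef hrank
  · intro e he
    by_cases heM : e ∈ M
    · have h1 : betterEdges p (fun e => if e ∈ M then 0 else r e + 1) S e = ∅ := by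
        simp [betterEdges, heM]
      have h2 : #(betterEdges q (fun e => if e ∈ M then S.sup s + 1 else s e) S e) <
          sideDegree q S (q e) := by
        refine card_lt_card (ssubset_iff_of_subset ?_ |>.2 ⟨e, ?_, ?_⟩)
        · intro f hf
          simp only [betterEdges, mem_filter] at hf ⊢
          exact ⟨hf.1, hf.2.1⟩
        · simp [he]
        · simp [betterEdges]
      rw [h1, card_empty, zero_add]
      exact lt_max_of_lt_right h2
    · have h0 := hb e (mem_sdiff.2 ⟨he, heM⟩)
      have h2 : betterEdges q (fun e => if e ∈ M then S.sup s + 1 else s e) S e ⊆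
          betterEdges q s (S \ M) e := by
        intro f hf
        have := hK e he
        simp only [betterEdges, mem_filter, mem_sdiff, heM, if_false] at hf ⊢
        by_cases hfM : f ∈ M
        · simp only [hfM, if_true] at hf
          omega
        · simpa [hfM] using hf
      have h1 : betterEdges p (fun e => if e ∈ M then 0 else r e + 1) S e ⊆
          betterEdges p r (S \ M) e ∪ {f ∈ M | p f = p e} := by
        intro f hf
        simp only [betterEdges, mem_union, mem_filter, mem_sdiff, heM, if_false] at hf ⊢
        by_cases hfM : f ∈ M
        · exact Or.inr ⟨hfM, hf.2.1⟩
        · simp only [hfM, if_false] at hf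
          exact Or.inl ⟨⟨hf.1, hfM⟩, hf.2.1, by omega⟩
      have c2 := card_le_card h2
      have c1 := (card_le_card h1).trans (card_union_le _ _)
      have dp := sideDegree_mono p (sdiff_subset (s := S) (t := M)) (p e)
      have dq := sideDegree_mono q (sdiff_subset (s := S) (t := M)) (q e)
      by_cases hpe : p e ∈ M.image p
      · have c3 : #{f ∈ M | p f = p e} ≤ 1 := by
          refine card_le_one.2 fun x hx y hy => ?_
          rw [mem_filter] at hx hy
          exact hp hx.1 hy.1 (hx.2.trans hy.2.symm)
        have dp' := sideDegree_sdiff_add_one_le hMS hpe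
        by_cases hqe : q e ∈ M.image q
        · have dq' := sideDegree_sdiff_add_one_le hMS hqe
          omega
        · have := hM e he hpe hqe
          omega
      · have c3 : #{f ∈ M | p f = p e} = 0 := by
          rw [card_eq_zero, filter_eq_empty_iff]
          exact fun f hf hfe => hpe (mem_image.2 ⟨f, hf, hfe⟩)
        omega

lemma exists_isGoodRanking [DecidableEq E] [DecidableEq A] [DecidableEq B]
    (p : E → A) (q : E → B) (S : Finset E) :
    ∃ r s : E → ℕ, IsGoodRanking p q S r s := by
  induction S using Finset.strongInduction with
  | H S ih =>
    obtain rfl | hS := S.eq_empty_or_nonempty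
    · exact ⟨fun _ => 0, fun _ => 0, by simp [IsGoodRanking, IsStrictRank]⟩
    rcases le_total #(S.image q) #(S.image p) with hcard | hcard
    · obtain ⟨M, hMS, hne, hp, hq, hM⟩ := exists_degree_dominating_matching p q S hS hcard
      obtain ⟨r, s, h⟩ := ih (S \ M) (sdiff_ssubset hMS hne)
      exact h.extend hMS hp hq hM
    · obtain ⟨M, hMS, hne, hq, hp, hM⟩ := exists_degree_dominating_matching q p S hS hcard
      obtain ⟨r, s, h⟩ := ih (S \ M) (sdiff_ssubset hMS hne)
      obtain ⟨s', r', h'⟩ := h.swap.extend hMS hq hp hM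
      exact ⟨r', s', h'.swap⟩

end BipartiteListColoring

lemma sideDegree_le_encard {V E : Type} [Fintype E] [DecidableEq V]
    {ends : E → Sym2 V} {L : E → Set ℕ} {p : E → V} (hp : ∀ e, p e ∈ ends e)
    (hf : ∀ x : V, ((multideg ends x : ℕ) : ℕ∞) ≤ (listInter ends L x).encard) (e : E) :
    ((sideDegree p univ (p e) : ℕ) : ℕ∞) ≤ (L e).encard := by
  classical
  have h1 : sideDegree p univ (p e) ≤ multideg ends (p e) := by
    rw [multideg, Nat.card_eq_fintype_card, Fintype.card_subtype]
    refine card_le_card fun f hf => ?_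
    rw [mem_filter] at hf ⊢
    exact ⟨hf.1, hf.2 ▸ hp f⟩
  exact (Nat.cast_le.2 h1).trans ((hf (p e)).trans
    (Set.encard_le_encard fun n hn => hn e (hp e)))

/-- **Local Kőnig theorem for lists.** If `G` is a finite loopless bipartite multigraph
and `L` is a list assignment on its edges with `|f(x,L)| ≥ deg(x)` for every vertex `x`,
then `G` admits a proper `L`-edge-coloring. -/
theorem local_konig_list_edge_coloring {V E : Type} [Fintype V] [Fintype E]
    (ends : E → Sym2 V) (hloopless : ∀ e : E, ¬ (ends e).IsDiag)
    (hbip : IsBipartiteMultigraph ends)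
    (L : E → Set ℕ)
    (hf : ∀ x : V, ((multideg ends x : ℕ) : ℕ∞) ≤ (listInter ends L x).encard) :
    ∃ φ : E → ℕ, IsProperLEdgeColoring ends L φ := by
  classical
  obtain ⟨X, hX⟩ := hbip
  choose p q hends hpX hqX using hX
  have hlist : ∀ e, ∃ l : Finset ℕ, (l : Set ℕ) ⊆ L e ∧
      #l = max (sideDegree p univ (p e)) (sideDegree q univ (q e)) := by
    intro e
    obtain ⟨t, htL, ht⟩ := Set.exists_subset_encard_eq
      (k := ((max (sideDegree p univ (p e)) (sideDegree q univ (q e)) : ℕ) : ℕ∞)) (s := L e) (by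
        rcases max_choice (sideDegree p univ (p e)) (sideDegree q univ (q e)) with h | h <;>
          rw [h]
        · exact sideDegree_le_encard (fun f => by simp [hends f]) hf e
        · exact sideDegree_le_encard (fun f => by simp [hends f]) hf e)
    have hfin : t.Finite := Set.finite_of_encard_eq_coe ht
    refine ⟨hfin.toFinset, by simpa using htL, ?_⟩
    rw [hfin.encard_eq_coe_toFinset_card] at ht
    exact_mod_cast ht
  choose l hlL hlcard using hlist
  obtain ⟨r, s, hr, hs, hlt⟩ := exists_isGoodRanking p q univ
  obtain ⟨φ, hφl, hφ⟩ := exists_coloring_of_card_betterEdges_lt p q r s univ l hr hs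
    (fun e he => by rw [hlcard]; exact hlt e he)
  refine ⟨φ, fun e => hlL e (hφl e (mem_univ e)), fun e f hne ⟨v, hve, hvf⟩ =>
    hφ e (mem_univ e) f (mem_univ f) hne ?_⟩
  rw [hends, Sym2.mem_iff] at hve hvf
  rcases hve with rfl | rfl <;> rcases hvf with h | h
  · exact Or.inl h
  · exact absurd (h ▸ hpX e) (hqX f)
  · exact absurd (h ▸ hpX f) (hqX e)
  · exact Or.inr h
end

section
/- Let G be a finite loopless multigraph. There is a proper edge-coloring φ : E(G) → ℕ such that for every edge e with endpoints x and y, φ(e) ∈ {1, …, max{deg(x) + ⌊deg(x)/2⌋, deg(y) + ⌊deg(y)/2⌋}}. -/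
/-- A proper edge-coloring: distinct edges sharing an endpoint get distinct colors. -/
def IsProperEdgeColoring {V E : Type} (ends : E → Sym2 V) (φ : E → ℕ) : Prop :=
  ∀ e f : E, e ≠ f → (∃ v : V, v ∈ ends e ∧ v ∈ ends f) → φ e ≠ φ f

/-- A coloring that is proper on the edges in `S`. -/
def ProperOn {V E : Type} (ends : E → Sym2 V) (S : Finset E) (φ : E → ℕ) : Prop :=
  ∀ e ∈ S, ∀ f ∈ S, e ≠ f → ∀ v, v ∈ ends e → v ∈ ends f → φ e ≠ φ f

/-- The color `c` is not used by the edges of `S` at the vertex `v`. -/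
def MissingAt {V E : Type} (ends : E → Sym2 V) (S : Finset E) (φ : E → ℕ) (v : V) (c : ℕ) :
    Prop :=
  ∀ e ∈ S, v ∈ ends e → φ e ≠ c

/-- The maximum degree of an endpoint of the edge `e`. -/
noncomputable def maxEndDegree {V E : Type} (ends : E → Sym2 V) (e : E) : ℕ :=
  Sym2.lift ⟨fun x y => max (multideg ends x) (multideg ends y), fun _ _ => max_comm _ _⟩ (ends e)

theorem maxEndDegree_eq {V E : Type} {ends : E → Sym2 V} {e : E} {x y : V}
    (h : ends e = s(x, y)) :
    maxEndDegree ends e = max (multideg ends x) (multideg ends y) := by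
  simp [maxEndDegree, h]

/-- In the orbit of a fixed point of an involution `s` under the dihedral group generated by `s`
and another involution `t`, there is at most one fixed point of `t`. -/
theorem exists_invariant_set_of_involutions {V : Type} {s t : Equiv.Perm V} (hs : s * s = 1)
    (ht : t * t = 1) {x y z : V} (hx : s x = x) (hy : t y = y) (hz : t z = z) (hyz : y ≠ z) :
    ∃ C : Set V, x ∈ C ∧ (y ∉ C ∨ z ∉ C) ∧ (∀ v, s v ∈ C ↔ v ∈ C) ∧ (∀ v, t v ∈ C ↔ v ∈ C) := by
  have hs' : ∀ v, s (s v) = v := fun v => by simpa using congrArg (fun p => p v) hs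
  have ht' : ∀ v, t (t v) = v := fun v => by simpa using congrArg (fun p => p v) ht
  have sinv : s⁻¹ = s := inv_eq_of_mul_eq_one_left hs
  have tinv : t⁻¹ = t := inv_eq_of_mul_eq_one_left ht
  set τ := t * s with hτ
  have hsemi : SemiconjBy s τ τ⁻¹ := by
    simp [SemiconjBy, hτ, mul_inv_rev, sinv, tinv, mul_assoc]
  have hsn : ∀ n : ℤ, s ((τ ^ n) x) = (τ ^ (-n)) x := fun n => by
    have := congrArg (fun p => p x) (hsemi.zpow_right n).eq
    simpa [hx] using this
  have htn : ∀ n : ℤ, t ((τ ^ n) x) = (τ ^ (1 - n)) x := fun n => by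
    have h1 : t ((τ ^ n) x) = τ (s ((τ ^ n) x)) := by simp [hτ, hs']
    rw [h1, hsn, sub_eq_add_neg, zpow_add τ, zpow_one, Equiv.Perm.mul_apply τ]
  have hper : ∀ n : ℤ, t ((τ ^ n) x) = (τ ^ n) x → (τ ^ (2 * n - 1)) x = x := fun n h => by
    rw [htn] at h
    have := congrArg (τ ^ (n - 1)) h
    rw [← Equiv.Perm.mul_apply, ← Equiv.Perm.mul_apply, ← zpow_add, ← zpow_add] at this
    rw [show 2 * n - 1 = n - 1 + n by ring, ← this]
    simp
  refine ⟨Set.range fun n : ℤ => (τ ^ n) x, ⟨0, by simp⟩, ?_, fun v => ⟨?_, ?_⟩, fun v => ⟨?_, ?_⟩⟩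
  · by_contra! h
    obtain ⟨⟨i, rfl⟩, ⟨j, rfl⟩⟩ := h
    have hi : (τ ^ (2 * i - 1)) x = x := hper i hy
    have hj : (τ ^ (2 * j - 1)) x = x := hper j hz
    apply hyz
    have hi2 : ∀ m : ℤ, (τ ^ ((2 * i - 1) * m)) x = x := fun m => by
      rw [zpow_mul]; exact Equiv.Perm.zpow_apply_eq_self_of_apply_eq_self hi m
    have hj2 : ∀ m : ℤ, (τ ^ ((2 * j - 1) * m)) x = x := fun m => by
      rw [zpow_mul]; exact Equiv.Perm.zpow_apply_eq_self_of_apply_eq_self hj m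
    have hij : (τ ^ (i - j)) x = x := by
      rw [show i - j = (2 * i - 1) * (1 - j) + (2 * j - 1) * (i - 1) by ring, zpow_add,
        Equiv.Perm.mul_apply, hj2, hi2]
    change (τ ^ i) x = (τ ^ j) x
    rw [show i = j + (i - j) by ring, zpow_add, Equiv.Perm.mul_apply, hij]
  · rintro ⟨n, hn⟩
    exact ⟨-n, by rw [← hs' v, ← hn]; exact (hsn n).symm⟩
  · rintro ⟨n, rfl⟩
    exact ⟨-n, (hsn n).symm⟩
  · rintro ⟨n, hn⟩
    exact ⟨1 - n, by rw [← ht' v, ← hn]; exact (htn n).symm⟩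
  · rintro ⟨n, rfl⟩
    exact ⟨1 - n, (htn n).symm⟩

/-- The edges of one color class of a proper coloring induce an involution of the vertices. -/
theorem ProperOn.exists_involution {V E : Type} {ends : E → Sym2 V} {S : Finset E} {φ : E → ℕ}
    (hφ : ProperOn ends S φ) (c : ℕ) :
    ∃ σ : Equiv.Perm V, σ * σ = 1 ∧
      (∀ e ∈ S, φ e = c → ∀ v w, ends e = s(v, w) → σ v = w) ∧
      ∀ v, MissingAt ends S φ v c → σ v = v := by
  classical
  let g : V → V := fun v =>
    if h : ∃ w, ∃ e ∈ S, φ e = c ∧ ends e = s(v, w) then h.choose else v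
  have hg : ∀ e ∈ S, φ e = c → ∀ v w, ends e = s(v, w) → g v = w := by
    intro e he hc v w hvw
    have h : ∃ w, ∃ e ∈ S, φ e = c ∧ ends e = s(v, w) := ⟨w, e, he, hc, hvw⟩
    obtain ⟨f, hf, hfc, hfw⟩ := h.choose_spec
    have hef : e = f := by
      by_contra hne
      exact hφ e he f hf hne v (by simp [hvw]) (by simp [hfw]) (hc.trans hfc.symm)
    subst hef
    rw [hvw] at hfw
    simp only [g, dif_pos h]
    exact (Sym2.congr_right.1 hfw).symm
  have hg' : ∀ v, (¬ ∃ w, ∃ e ∈ S, φ e = c ∧ ends e = s(v, w)) → g v = v := fun v h => by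
    simp only [g, dif_neg h]
  have hinv : Function.Involutive g := by
    intro v
    by_cases h : ∃ w, ∃ e ∈ S, φ e = c ∧ ends e = s(v, w)
    · obtain ⟨w, e, he, hc, hvw⟩ := h
      rw [hg e he hc v w hvw]
      exact hg e he hc w v (hvw.trans Sym2.eq_swap)
    · rw [hg' v h, hg' v h]
  refine ⟨hinv.toPerm, ?_, hg, fun v hv => hg' v ?_⟩
  · ext v
    exact hinv v
  · rintro ⟨w, e, he, hc, hvw⟩
    exact hv e he (by simp [hvw]) hc

/-- A Kempe change of the colors `a` and `c` along the chain starting at `x`. -/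
theorem ProperOn.exists_kempe_change {V E : Type} {ends : E → Sym2 V} {S : Finset E} {φ : E → ℕ}
    (hφ : ProperOn ends S φ) {a c : ℕ} {x y z : V} (hx : MissingAt ends S φ x a)
    (hy : MissingAt ends S φ y c) (hz : MissingAt ends S φ z c) (hyz : y ≠ z) :
    ∃ ψ : E → ℕ, ProperOn ends S ψ ∧
      (∀ e ∈ S, ψ e = φ e ∨ ((φ e = a ∨ φ e = c) ∧ (ψ e = a ∨ ψ e = c))) ∧
      MissingAt ends S ψ x c ∧ (MissingAt ends S ψ y c ∨ MissingAt ends S ψ z c) := by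
  classical
  obtain ⟨s, hs, hse, hsm⟩ := hφ.exists_involution a
  obtain ⟨t, ht, hte, htm⟩ := hφ.exists_involution c
  obtain ⟨C, hxC, hyzC, hsC, htC⟩ :=
    exists_invariant_set_of_involutions hs ht (hsm x hx) (htm y hy) (htm z hz) hyz
  let ψ : E → ℕ := fun e => if ∃ v ∈ ends e, v ∈ C then Equiv.swap a c (φ e) else φ e
  have key : ∀ e ∈ S, ∀ v ∈ ends e, ψ e = if v ∈ C then Equiv.swap a c (φ e) else φ e := by
    intro e he v hv
    obtain ⟨w, hw⟩ := hv
    by_cases hv : v ∈ C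
    · simp only [ψ]
      rw [if_pos hv, if_pos ⟨v, by simp [hw], hv⟩]
    · rw [if_neg hv]
      by_cases hwC : w ∈ C
      · have h1 : φ e ≠ a := fun h => hv ((hsC v).1 (by rwa [hse e he h v w hw]))
        have h2 : φ e ≠ c := fun h => hv ((htC v).1 (by rwa [hte e he h v w hw]))
        simp only [ψ, Equiv.swap_apply_of_ne_of_ne h1 h2, ite_self]
      · simp only [ψ]
        rw [if_neg]
        rw [hw]
        simp [hv, hwC]
  have hout : ∀ v, v ∉ C → MissingAt ends S φ v c → MissingAt ends S ψ v c := by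
    intro v hv hm e he hve
    rw [key e he v hve, if_neg hv]
    exact hm e he hve
  refine ⟨ψ, ?_, ?_, ?_, hyzC.imp (hout y · hy) (hout z · hz)⟩
  · intro e he f hf hne v hve hvf
    rw [key e he v hve, key f hf v hvf]
    have := hφ e he f hf hne v hve hvf
    split_ifs
    · simpa using this
    · exact this
  · intro e he
    by_cases h1 : φ e = a
    · right
      simp only [ψ, h1, Equiv.swap_apply_left]
      split_ifs <;> simp
    by_cases h2 : φ e = c
    · right
      simp only [ψ, h2, Equiv.swap_apply_right]
      split_ifs <;> simp
    · left
      simp only [ψ, Equiv.swap_apply_of_ne_of_ne h1 h2, ite_self]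
  · intro e he hxe h
    rw [key e he x hxe, if_pos hxC] at h
    exact hx e he hxe (by rw [← Equiv.swap_apply_self a c (φ e), h, Equiv.swap_apply_right])

theorem ProperOn.insert_update {V E : Type} [DecidableEq E] {ends : E → Sym2 V} {S : Finset E}
    {φ : E → ℕ} (hφ : ProperOn ends S φ) {e : E} {x y : V} (he : ends e = s(x, y)) {c : ℕ}
    (hx : ∀ f ∈ S, f ≠ e → x ∈ ends f → φ f ≠ c)
    (hy : ∀ f ∈ S, f ≠ e → y ∈ ends f → φ f ≠ c) :
    ProperOn ends (insert e S) (Function.update φ e c) := by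
  have h : ∀ f ∈ S, f ≠ e → ∀ v, v ∈ ends e → v ∈ ends f → φ f ≠ c := by
    intro f hf hne v hv hvf
    rw [he, Sym2.mem_iff] at hv
    obtain rfl | rfl := hv
    · exact hx f hf hne hvf
    · exact hy f hf hne hvf
  intro f hf g hg hfg v hvf hvg
  rw [Finset.mem_insert] at hf hg
  by_cases h1 : f = e
  · subst h1
    simpa [Ne.symm hfg] using (h g (hg.resolve_left (Ne.symm hfg)) (Ne.symm hfg) v hvf hvg).symm
  by_cases h2 : g = e
  · subst h2
    simpa [hfg] using h f (hf.resolve_left h1) hfg v hvg hvf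
  simpa [h1, h2] using hφ f (hf.resolve_left h1) g (hg.resolve_left h2) hfg v hvf hvg

/-- Recolor the edge `f` by `c` and give its old color to the new edge `e`. -/
theorem ProperOn.shift {V E : Type} [DecidableEq E] {ends : E → Sym2 V} {S : Finset E}
    {φ : E → ℕ} (hφ : ProperOn ends S φ) {e f : E} (hfS : f ∈ S) {x y z : V}
    (he : ends e = s(x, y)) (hf : ends f = s(x, z)) (hy : MissingAt ends S φ y (φ f)) {c : ℕ}
    (hx : MissingAt ends S φ x c) (hz : MissingAt ends S φ z c) :
    ProperOn ends (insert e S) (Function.update (Function.update φ f c) e (φ f)) := by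
  have hc : φ f ≠ c := hx f hfS (by simp [hf])
  have h1 : ProperOn ends S (Function.update φ f c) := by
    simpa [hfS] using hφ.insert_update hf (fun g hg _ => hx g hg) (fun g hg _ => hz g hg)
  refine h1.insert_update he ?_ ?_
  · intro g hg _ hxg
    by_cases hgf : g = f
    · simpa [hgf] using hc.symm
    · simpa [hgf] using hφ g hg f hfS hgf x hxg (by simp [hf])
  · intro g hg _ hyg
    by_cases hgf : g = f
    · simpa [hgf] using hc.symm
    · simpa [hgf] using hy g hg hyg

open Classical in
/-- The colors below `K` missing at `v`. -/
noncomputable def missingColors {V E : Type} (ends : E → Sym2 V) (S : Finset E) (φ : E → ℕ)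
    (K : ℕ) (v : V) : Finset ℕ :=
  {c ∈ Finset.range K | MissingAt ends S φ v c}

theorem mem_missingColors {V E : Type} {ends : E → Sym2 V} {S : Finset E} {φ : E → ℕ} {K : ℕ}
    {v : V} {c : ℕ} :
    c ∈ missingColors ends S φ K v ↔ c < K ∧ MissingAt ends S φ v c := by
  simp [missingColors]

open Classical in
theorem le_card_missingColors_add {V E : Type} (ends : E → Sym2 V) (S : Finset E) (φ : E → ℕ)
    (K : ℕ) (v : V) :
    K ≤ (missingColors ends S φ K v).card + (S.filter (v ∈ ends ·)).card := by
  have h : Finset.range K ⊆ missingColors ends S φ K v ∪ (S.filter (v ∈ ends ·)).image φ := by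
    intro c hc
    by_cases hm : MissingAt ends S φ v c
    · exact Finset.mem_union_left _ (mem_missingColors.2 ⟨Finset.mem_range.1 hc, hm⟩)
    · simp only [MissingAt, not_forall, not_not] at hm
      obtain ⟨e, he, hv, rfl⟩ := hm
      exact Finset.mem_union_right _ (Finset.mem_image_of_mem _ (by simp [he, hv]))
  calc K = (Finset.range K).card := by simp
    _ ≤ _ := Finset.card_le_card h
    _ ≤ _ := Finset.card_union_le _ _
    _ ≤ _ := by gcongr; exact Finset.card_image_le

theorem le_card_missingColors_add_multideg {V E : Type} [Fintype E] (ends : E → Sym2 V)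
    (S : Finset E) (φ : E → ℕ) (K : ℕ) (v : V) :
    K ≤ (missingColors ends S φ K v).card + multideg ends v := by
  classical
  refine (le_card_missingColors_add ends S φ K v).trans ?_
  rw [multideg, Nat.card_eq_fintype_card, Fintype.card_subtype]
  gcongr
  exact S.subset_univ

theorem lt_card_missingColors_add_multideg {V E : Type} [Fintype E] {ends : E → Sym2 V}
    {S : Finset E} {e : E} (heS : e ∉ S) {v : V} (hv : v ∈ ends e) (φ : E → ℕ) (K : ℕ) :
    K < (missingColors ends S φ K v).card + multideg ends v := by
  classical
  refine (le_card_missingColors_add ends S φ K v).trans_lt ?_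
  rw [multideg, Nat.card_eq_fintype_card, Fintype.card_subtype]
  gcongr
  refine Finset.ssubset_iff_subset_ne.2 ⟨Finset.filter_subset_filter _ S.subset_univ, fun h => ?_⟩
  have : e ∈ S.filter (v ∈ ends ·) := by rw [h]; simp [hv]
  exact heS (Finset.mem_filter.1 this).1

/-- A local coloring of edges with large endpoint degrees extends to one more edge. -/
theorem ProperOn.exists_extension {V E : Type} [Fintype E] [DecidableEq E] {ends : E → Sym2 V}
    {S : Finset E} {φ : E → ℕ} (hφ : ProperOn ends S φ)
    (hbound : ∀ e ∈ S, φ e < maxEndDegree ends e + maxEndDegree ends e / 2) {e : E} (heS : e ∉ S)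
    (hmin : ∀ f ∈ S, maxEndDegree ends e ≤ maxEndDegree ends f) :
    ∃ ψ : E → ℕ, ProperOn ends (insert e S) ψ ∧
      ∀ f ∈ insert e S, ψ f < maxEndDegree ends f + maxEndDegree ends f / 2 := by
  obtain ⟨x, y, hxy, hle⟩ : ∃ x y, ends e = s(x, y) ∧ multideg ends y ≤ multideg ends x := by
    induction h : ends e with
    | h u v =>
      rcases le_total (multideg ends u) (multideg ends v) with h' | h'
      · exact ⟨v, u, Sym2.eq_swap, h'⟩
      · exact ⟨u, v, rfl, h'⟩
  have hDe : maxEndDegree ends e = multideg ends x := by rw [maxEndDegree_eq hxy, max_eq_left hle]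
  set d := multideg ends x with hd
  rw [hDe] at hmin
  have hmin' : ∀ f ∈ S, d + d / 2 ≤ maxEndDegree ends f + maxEndDegree ends f / 2 := fun f hf => by
    have := hmin f hf
    omega
  have extend : ∀ ψ : E → ℕ, ∀ c : ℕ, ProperOn ends S ψ →
      (∀ f ∈ S, ψ f < maxEndDegree ends f + maxEndDegree ends f / 2) →
      c < d + d / 2 → MissingAt ends S ψ x c → MissingAt ends S ψ y c →
      ∃ ψ : E → ℕ, ProperOn ends (insert e S) ψ ∧
        ∀ f ∈ insert e S, ψ f < maxEndDegree ends f + maxEndDegree ends f / 2 := by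
    intro ψ c hψ hb hc hx hy
    refine ⟨_, hψ.insert_update hxy (fun g hg _ => hx g hg) (fun g hg _ => hy g hg), ?_⟩
    intro f hf
    by_cases h : f = e
    · subst h
      simpa [hDe] using hc
    · simpa [h] using hb f (Finset.mem_of_mem_insert_of_ne hf h)
  have hxM := lt_card_missingColors_add_multideg heS (hxy ▸ Sym2.mem_mk_left x y) φ
  have hyM := lt_card_missingColors_add_multideg heS (hxy ▸ Sym2.mem_mk_right x y) φ (d + d / 2)
  obtain ⟨b, hb⟩ : (missingColors ends S φ (d + d / 2) y).Nonempty := by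
    rw [← Finset.card_pos]; omega
  obtain ⟨a, ha⟩ : (missingColors ends S φ (d + d / 2) x).Nonempty := by
    have := hxM (d + d / 2)
    rw [← Finset.card_pos]; omega
  rw [mem_missingColors] at ha hb
  by_cases hxb : MissingAt ends S φ x b
  · exact extend φ b hφ hbound hb.1 hxb hb.2
  simp only [MissingAt, not_forall, not_not] at hxb
  obtain ⟨f, hfS, ⟨z, hxz⟩, rfl⟩ := hxb
  have hyz : y ≠ z := by
    rintro rfl
    exact hb.2 f hfS (by simp [hxz]) rfl
  have shift : ∀ ψ : E → ℕ, ∀ c : ℕ, ProperOn ends S ψ →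
      (∀ f ∈ S, ψ f < maxEndDegree ends f + maxEndDegree ends f / 2) → ψ f = φ f →
      c < maxEndDegree ends f + maxEndDegree ends f / 2 → MissingAt ends S ψ y (φ f) →
      MissingAt ends S ψ x c → MissingAt ends S ψ z c →
      ∃ ψ : E → ℕ, ProperOn ends (insert e S) ψ ∧
        ∀ f ∈ insert e S, ψ f < maxEndDegree ends f + maxEndDegree ends f / 2 := by
    intro ψ c hψ hbd hf hc hy hx hz
    refine ⟨_, hψ.shift hfS hxy hxz (by rwa [hf]) hx hz, ?_⟩
    intro g hg
    by_cases h : g = e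
    · subst h
      simpa [hDe, hf] using hb.1
    · by_cases h' : g = f
      · subst h'
        simpa [h] using hc
      · simpa [h, h'] using hbd g (Finset.mem_of_mem_insert_of_ne hg h)
  by_cases hkempe : ∃ c < d + d / 2, MissingAt ends S φ y c ∧ MissingAt ends S φ z c
  · obtain ⟨c, hc, hyc, hzc⟩ := hkempe
    obtain ⟨ψ, hψ, hch, hxψ, hyzψ⟩ := hφ.exists_kempe_change ha.2 hyc hzc hyz
    have hψb : ∀ g ∈ S, ψ g < maxEndDegree ends g + maxEndDegree ends g / 2 := by
      intro g hg
      have h1 := hbound g hg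
      have h2 := hmin' g hg
      have h3 := ha.1
      rcases hch g hg with h | ⟨-, h | h⟩ <;> omega
    have hfa : φ f ≠ a := ha.2 f hfS (by simp [hxz])
    have hfc : φ f ≠ c := hzc f hfS (by simp [hxz])
    rcases hyzψ with h | h
    · exact extend ψ c hψ hψb hc hxψ h
    · refine shift ψ c hψ hψb ?_ (hc.trans_le (hmin' f hfS)) ?_ hxψ h
      · have := hch f hfS
        tauto
      · intro g hg hyg
        have := hb.2 g hg hyg
        rcases hch g hg with h | ⟨-, h | h⟩ <;> rw [h]
        · exact this
        · exact hfa.symm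
        · exact hfc.symm
  have hDf := maxEndDegree_eq hxz
  set K := maxEndDegree ends f + maxEndDegree ends f / 2 with hK
  have hkK : d + d / 2 ≤ K := hmin' f hfS
  by_cases hxzc : ∃ c < K, MissingAt ends S φ x c ∧ MissingAt ends S φ z c
  · obtain ⟨c, hc, hxc, hzc⟩ := hxzc
    exact shift φ c hφ hbound rfl hc hb.2 hxc hzc
  by_cases hxyc : ∃ c < d + d / 2, MissingAt ends S φ x c ∧ MissingAt ends S φ y c
  · obtain ⟨c, hc, hxc, hyc⟩ := hxyc
    exact extend φ c hφ hbound hc hxc hyc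
  exfalso
  push Not at hkempe hxzc hxyc
  have hd1 : Disjoint (missingColors ends S φ K x) (missingColors ends S φ K z) := by
    rw [Finset.disjoint_left]
    intro c h1 h2
    rw [mem_missingColors] at h1 h2
    exact hxzc c h1.1 h1.2 h2.2
  have hd2 : Disjoint (missingColors ends S φ K x ∪ missingColors ends S φ K z)
      (missingColors ends S φ (d + d / 2) y) := by
    rw [Finset.disjoint_left]
    intro c h1 h2
    rw [Finset.mem_union, mem_missingColors, mem_missingColors] at h1
    rw [mem_missingColors] at h2
    rcases h1 with h1 | h1
    · exact hxyc c h2.1 h1.2 h2.2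
    · exact hkempe c h2.1 h2.2 h1.2
  have hsub : missingColors ends S φ K x ∪ missingColors ends S φ K z ∪
      missingColors ends S φ (d + d / 2) y ⊆ Finset.range K := by
    intro c hc
    simp only [Finset.mem_union, mem_missingColors] at hc
    rw [Finset.mem_range]
    omega
  have hcard := Finset.card_le_card hsub
  rw [Finset.card_union_of_disjoint hd2, Finset.card_union_of_disjoint hd1, Finset.card_range]
    at hcard
  have hxK := hxM K
  have hzK := le_card_missingColors_add_multideg ends S φ K z
  rcases max_cases d (multideg ends z) with h | h <;> omega

theorem exists_properOn_lt {V E : Type} [Fintype E] (ends : E → Sym2 V) (S : Finset E) :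
    ∃ φ : E → ℕ, ProperOn ends S φ ∧
      ∀ e ∈ S, φ e < maxEndDegree ends e + maxEndDegree ends e / 2 := by
  classical
  induction S using Finset.induction_on_min_value (maxEndDegree ends) with
  | empty => exact ⟨0, by simp [ProperOn], by simp⟩
  | insert e S heS hmin ih =>
    obtain ⟨φ, hφ, hb⟩ := ih
    exact hφ.exists_extension hb heS hmin

/-- **Local Shannon theorem.** Every finite loopless multigraph has a proper
edge-coloring `φ` such that every edge `e` with endpoints `x, y` satisfies
`φ(e) ∈ {1, …, max{deg(x) + ⌊deg(x)/2⌋, deg(y) + ⌊deg(y)/2⌋}}`. -/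
theorem local_shannon_edge_coloring {V E : Type} [Fintype V] [Fintype E]
    (ends : E → Sym2 V) (hloopless : ∀ e : E, ¬ (ends e).IsDiag) :
    ∃ φ : E → ℕ, IsProperEdgeColoring ends φ ∧
      ∀ (e : E) (x y : V), ends e = s(x, y) →
        φ e ∈ Finset.Icc 1
          (max (multideg ends x + multideg ends x / 2)
               (multideg ends y + multideg ends y / 2)) := by
  obtain ⟨φ, hφ, hb⟩ := exists_properOn_lt ends Finset.univ
  refine ⟨fun e => φ e + 1, ?_, ?_⟩
  · rintro e f hne ⟨v, hve, hvf⟩ h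
    exact hφ e (Finset.mem_univ e) f (Finset.mem_univ f) hne v hve hvf (Nat.succ_injective h)
  · intro e x y hxy
    have h := hb e (Finset.mem_univ e)
    rw [maxEndDegree_eq hxy] at h
    refine Finset.mem_Icc.2 ⟨Nat.le_add_left 1 _, Nat.succ_le_of_lt (h.trans_le ?_)⟩
    rcases max_choice (multideg ends x) (multideg ends y) with h' | h' <;> rw [h']
    · exact le_max_left _ _
    · exact le_max_right _ _
end

section
/- Let G be a finite loopless bipartite multigraph. There is a proper edge-coloring φ : E(G) → ℕ such that for every edge e with endpoints x and y, φ(e) ∈ {1, …, max{deg(x), deg(y)}}. -/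
open Classical in
/-- A square matrix over `ℕ` whose rows and columns all have the same positive sum has a
permutation of its indices supported on nonzero entries. -/
theorem exists_perm_of_row_col_sum_eq {V : Type} [Fintype V] (M : V → V → ℕ) {d : ℕ}
    (hd : 0 < d) (hrow : ∀ u, ∑ v, M u v = d) (hcol : ∀ v, ∑ u, M u v = d) :
    ∃ σ : Equiv.Perm V, ∀ v, M v (σ v) ≠ 0 := by
  obtain ⟨f, hf, hM⟩ := (Finset.all_card_le_biUnion_card_iff_exists_injective
    (fun u : V => Finset.univ.filter fun v => M u v ≠ 0)).1 (fun S => by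
      set N := S.biUnion (fun u : V => Finset.univ.filter fun v => M u v ≠ 0) with hN
      refine Nat.le_of_mul_le_mul_right ?_ hd
      calc S.card * d = ∑ u ∈ S, ∑ v, M u v := by simp [hrow]
        _ = ∑ u ∈ S, ∑ v ∈ N, M u v := by
            refine Finset.sum_congr rfl fun u hu => ?_
            refine (Finset.sum_subset (Finset.subset_univ _) fun v _ hv => ?_).symm
            by_contra h
            exact hv (Finset.mem_biUnion.2 ⟨u, hu, by simp [h]⟩)
        _ = ∑ v ∈ N, ∑ u ∈ S, M u v := Finset.sum_comm
        _ ≤ ∑ v ∈ N, ∑ u, M u v :=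
            Finset.sum_le_sum fun v _ => Finset.sum_le_sum_of_subset (Finset.subset_univ _)
        _ = N.card * d := by simp [hcol])
  exact ⟨Equiv.ofBijective f (Finite.injective_iff_bijective.1 hf),
    fun v => by simpa using hM v⟩

/-- The degree of `u` is the sum over all `v` of the multiplicity of the pair `u, v`. -/
theorem sum_card_ends_eq_multideg {V E : Type} [Fintype V] [Finite E]
    (ends : E → Sym2 V) (u : V) :
    ∑ v, Nat.card {e : E // ends e = s(u, v)} = multideg ends u := by
  rw [← Nat.card_sigma]
  refine Nat.card_congr (Equiv.ofBijective
    (fun p : Σ v, {e : E // ends e = s(u, v)} =>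
      (⟨p.2.1, by simp [p.2.2]⟩ : {e : E // u ∈ ends e})) ⟨?_, ?_⟩)
  · rintro ⟨v, e, he⟩ ⟨w, f, hf⟩ h
    obtain rfl : e = f := congrArg Subtype.val h
    obtain rfl : v = w := Sym2.congr_right.1 (he.symm.trans hf)
    rfl
  · rintro ⟨e, v, hv⟩
    exact ⟨⟨v, e, hv⟩, rfl⟩

open Classical in
/-- In a bipartite multigraph of maximum degree at most `d`, some matching covers all vertices
of degree `d`, and each of its edges has an endpoint of degree `d`. -/
theorem exists_matching_covering_max_degree {V E : Type} [Fintype V] [Finite E]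
    (ends : E → Sym2 V) (hbip : IsBipartiteMultigraph ends) {d : ℕ} (hd : 0 < d)
    (hdeg : ∀ x, multideg ends x ≤ d) :
    ∃ M : Set E, (∀ e ∈ M, ∀ f ∈ M, ∀ v, v ∈ ends e → v ∈ ends f → e = f) ∧
      (∀ x, multideg ends x = d → ∃ e ∈ M, x ∈ ends e) ∧
      ∀ e ∈ M, ∃ x ∈ ends e, multideg ends x = d := by
  obtain ⟨A, hA⟩ := hbip
  have hrow : ∀ u, ∑ v, (Nat.card {e : E // ends e = s(u, v)} +
      if u = v then d - multideg ends u else 0) = d := fun u => by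
    rw [Finset.sum_add_distrib, sum_card_ends_eq_multideg]
    simp [hdeg u]
  obtain ⟨σ, hσ⟩ := exists_perm_of_row_col_sum_eq
    (fun u v => Nat.card {e : E // ends e = s(u, v)} +
      if u = v then d - multideg ends u else 0) hd hrow (fun v => by
        refine Eq.trans ?_ (hrow v)
        refine Finset.sum_congr rfl fun u _ => ?_
        rw [Sym2.eq_swap]
        by_cases h : u = v
        · subst h; rfl
        · simp [h, Ne.symm h])
  have hedge : ∀ v, (multideg ends v = d ∨ multideg ends (σ v) = d) →
      ∃ e, ends e = s(v, σ v) := fun v hv => by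
    by_contra! hne
    have : IsEmpty {e : E // ends e = s(v, σ v)} := ⟨fun e => hne e.1 e.2⟩
    have h := hσ v
    simp only [Nat.card_of_isEmpty, zero_add] at h
    split_ifs at h with hv'
    · rw [← hv'] at hv
      omega
    · exact h rfl
  choose g hg using hedge
  refine ⟨{e | ∃ v ∈ A, ∃ h : multideg ends v = d ∨ multideg ends (σ v) = d, e = g v h},
    ?_, ?_, ?_⟩
  · have hB : ∀ v ∈ A, (multideg ends v = d ∨ multideg ends (σ v) = d) → σ v ∉ A := by
      intro v hv hvd
      obtain ⟨a, b, hab, ha, hb⟩ := hA (g v hvd)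
      rw [hg v hvd, Sym2.eq_iff] at hab
      rcases hab with ⟨rfl, h⟩ | ⟨rfl, h⟩
      · rwa [h]
      · exact absurd hv hb
    rintro _ ⟨v, hv, hvd, rfl⟩ _ ⟨w, hw, hwd, rfl⟩ x hxv hxw
    rw [hg v hvd, Sym2.mem_iff] at hxv
    rw [hg w hwd, Sym2.mem_iff] at hxw
    have hBv := hB v hv hvd
    have hBw := hB w hw hwd
    rcases hxv with rfl | rfl <;> rcases hxw with h | h
    · subst h; rfl
    · exact absurd (h ▸ hv) hBw
    · exact absurd (h ▸ hw) hBv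
    · obtain rfl := σ.injective h
      rfl
  · intro x hx
    by_cases hxA : x ∈ A
    · exact ⟨g x (.inl hx), ⟨x, hxA, .inl hx, rfl⟩, by simp [hg x (.inl hx)]⟩
    · have hvd : multideg ends (σ.symm x) = d ∨ multideg ends (σ (σ.symm x)) = d := by
        simp [hx]
      have he := hg _ hvd
      refine ⟨g (σ.symm x) hvd, ⟨σ.symm x, ?_, hvd, rfl⟩, by simp [he]⟩
      obtain ⟨a, b, hab, ha, hb⟩ := hA (g (σ.symm x) hvd)
      rw [he, σ.apply_symm_apply, Sym2.eq_iff] at hab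
      rcases hab with ⟨h, -⟩ | ⟨-, h⟩
      · rwa [h]
      · exact absurd (h ▸ ha) hxA
  · rintro _ ⟨v, -, hvd, rfl⟩
    rw [hg v hvd]
    rcases hvd with h | h
    · exact ⟨v, by simp, h⟩
    · exact ⟨σ v, by simp, h⟩

theorem multideg_comp_val_le {V E : Type} [Finite E] (ends : E → Sym2 V) (p : E → Prop) (x : V) :
    multideg (fun e : Subtype p => ends e) x ≤ multideg ends x :=
  Nat.card_le_card_of_injective
    (fun e => (⟨e.1.1, e.2⟩ : {e : E // x ∈ ends e}))
    fun _ _ h => Subtype.ext (Subtype.ext (Subtype.mk.inj h))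

theorem multideg_comp_val_lt {V E : Type} [Finite E] (ends : E → Sym2 V) (p : E → Prop) {x : V}
    {e : E} (hx : x ∈ ends e) (he : ¬ p e) :
    multideg (fun e : Subtype p => ends e) x < multideg ends x := by
  have := Fintype.ofFinite {e : Subtype p // x ∈ ends e}
  have := Fintype.ofFinite {e : E // x ∈ ends e}
  unfold multideg
  rw [Nat.card_eq_fintype_card, Nat.card_eq_fintype_card]
  refine Fintype.card_lt_of_injective_of_notMem
    (fun e => (⟨e.1.1, e.2⟩ : {e : E // x ∈ ends e}))
    (fun e f h => Subtype.ext (Subtype.ext (Subtype.mk.inj h))) (b := ⟨e, hx⟩) ?_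
  rintro ⟨f, hf⟩
  exact he (Subtype.mk.inj hf ▸ f.1.2)

theorem multideg_pos {V E : Type} [Finite E] (ends : E → Sym2 V) {x : V} {e : E}
    (hx : x ∈ ends e) : 0 < multideg ends x :=
  have : Nonempty {e : E // x ∈ ends e} := ⟨⟨e, hx⟩⟩
  Nat.card_pos

open Classical in
/-- The local Kőnig theorem, for multigraphs of maximum degree at most `d`. -/
theorem local_konig_edge_coloring_of_multideg_le {V : Type} [Fintype V] (d : ℕ) :
    ∀ {E : Type} [Finite E] (ends : E → Sym2 V),
      IsBipartiteMultigraph ends → (∀ x, multideg ends x ≤ d) →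
      ∃ φ : E → ℕ, IsProperEdgeColoring ends φ ∧
        ∀ (e : E) (x y : V), ends e = s(x, y) →
          φ e ∈ Finset.Icc 1 (max (multideg ends x) (multideg ends y)) := by
  induction d with
  | zero =>
    intro E _ ends _ hdeg
    have hE : ∀ e : E, False := fun e => by
      obtain ⟨x, hx⟩ : ∃ x, x ∈ ends e := ⟨_, (ends e).out_fst_mem⟩
      have := multideg_pos ends hx
      have := hdeg x
      omega
    exact ⟨fun _ => 0, fun e => (hE e).elim, fun e => (hE e).elim⟩
  | succ d ih =>
    intro E _ ends hbip hdeg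
    obtain ⟨M, hM, hcover, hmax⟩ :=
      exists_matching_covering_max_degree ends hbip d.succ_pos hdeg
    have hdeg' : ∀ x, multideg (fun e : {e // e ∉ M} => ends e) x ≤ d := fun x => by
      rcases (hdeg x).lt_or_eq with h | h
      · exact (multideg_comp_val_le ends _ x).trans (Nat.le_of_lt_succ h)
      · obtain ⟨e, he, hx⟩ := hcover x h
        have := multideg_comp_val_lt ends (fun e => e ∉ M) hx (not_not.2 he)
        omega
    obtain ⟨φ, hφ, hrange⟩ := ih (fun e : {e // e ∉ M} => ends e)
      (hbip.imp fun A hA e => hA e) hdeg'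
    have hle : ∀ e, φ e ≤ d := fun e => by
      obtain ⟨x, y, hxy⟩ : ∃ x y, ends e = s(x, y) := by
        induction ends e using Sym2.ind with
        | _ x y => exact ⟨x, y, rfl⟩
      exact (Finset.mem_Icc.1 (hrange e x y hxy)).2.trans (max_le (hdeg' x) (hdeg' y))
    refine ⟨fun e => if h : e ∈ M then d + 1 else φ ⟨e, h⟩, ?_, ?_⟩
    · rintro e f hef ⟨v, hve, hvf⟩
      by_cases he : e ∈ M <;> by_cases hf : f ∈ M
      · exact absurd (hM e he f hf v hve hvf) hef
      · have := hle ⟨f, hf⟩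
        simp only [he, hf, dite_true, dite_false]
        omega
      · have := hle ⟨e, he⟩
        simp only [he, hf, dite_true, dite_false]
        omega
      · simp only [he, hf, dite_false]
        exact hφ _ _ (fun h => hef (congrArg Subtype.val h)) ⟨v, hve, hvf⟩
    · intro e x y hxy
      by_cases he : e ∈ M
      · simp only [he, dite_true, Finset.mem_Icc]
        obtain ⟨z, hz, hzd⟩ := hmax e he
        rw [hxy, Sym2.mem_iff] at hz
        rcases hz with rfl | rfl <;> omega
      · simp only [he, dite_false]
        exact Finset.Icc_subset_Icc_right (max_le_max (multideg_comp_val_le ends _ x)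
          (multideg_comp_val_le ends _ y)) (hrange ⟨e, he⟩ x y hxy)

/-- **Local Kőnig theorem.** Every finite loopless bipartite multigraph has a proper
edge-coloring `φ` such that every edge `e` with endpoints `x, y` satisfies
`φ(e) ∈ {1, …, max{deg(x), deg(y)}}`. -/
theorem local_konig_edge_coloring {V E : Type} [Fintype V] [Fintype E]
    (ends : E → Sym2 V) (hloopless : ∀ e : E, ¬ (ends e).IsDiag)
    (hbip : IsBipartiteMultigraph ends) :
    ∃ φ : E → ℕ, IsProperEdgeColoring ends φ ∧
      ∀ (e : E) (x y : V), ends e = s(x, y) →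
        φ e ∈ Finset.Icc 1 (max (multideg ends x) (multideg ends y)) :=
  local_konig_edge_coloring_of_multideg_le (Nat.card E) ends hbip
    fun _ => Nat.card_le_card_of_injective _ Subtype.val_injective
end
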